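/- Let γ > 1, φ, ψ ∈ C¹_b(ℝ), μ = 1, and 0 ≤ λ < 2. Then there exist constants ε₀ > 0 and C > 0 such that for every 0 < ε ≤ ε₀, the Cauchy problem u_t − v_x = 0, v_t + p(u)_x = −(λ/(1+t)) v with initial data (u(0,x), v(0,x)) = (1 + εφ(x), εψ(x)) admits a C¹_b solution with u positive on [0, C ε^{−2/(2−λ)}] × ℝ; i.e., the lifespan satisfies T* ≥ C ε^{−2/(2−λ)}. -/

import Mathlib

noncomputable section
open Real Set

/-- Partial derivative with respect to time of a function of `(t, x)`. -/
def pdt (f : ℝ → ℝ → ℝ) (t x : ℝ) : ℝ := deriv (fun τ => f τ x) t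

/-- Partial derivative with respect to space of a function of `(t, x)`. -/
def pdx (f : ℝ → ℝ → ℝ) (t x : ℝ) : ℝ := deriv (fun ξ => f t ξ) x

/-- The strip `[0,T] × ℝ`. -/
def strip (T : ℝ) : Set (ℝ × ℝ) := Set.Icc 0 T ×ˢ (Set.univ : Set ℝ)

/-- The half-space `[0,∞) × ℝ`. -/
def stripInf : Set (ℝ × ℝ) := Set.Ici (0 : ℝ) ×ˢ (Set.univ : Set ℝ)

/-- The pressure `p(u) = u^(-γ)/γ`. -/
def pres (γ u : ℝ) : ℝ := u ^ (-γ) / γ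

/-- The sound speed `c(u) = u^(-(γ+1)/2)`. -/
def cspeed (γ u : ℝ) : ℝ := u ^ (-(γ + 1) / 2)

/-- The first Riemann invariant `r = v - (2/(γ-1)) u^(-(γ-1)/2) + 2/(γ-1)`. -/
def rInv (γ u v : ℝ) : ℝ := v - (2 / (γ - 1)) * u ^ (-(γ - 1) / 2) + 2 / (γ - 1)

/-- The second Riemann invariant `s = v + (2/(γ-1)) u^(-(γ-1)/2) - 2/(γ-1)`. -/
def sInv (γ u v : ℝ) : ℝ := v + (2 / (γ - 1)) * u ^ (-(γ - 1) / 2) - 2 / (γ - 1)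

/-- `(u,v)` solves the damped compressible Euler system on the set `S`. -/
def IsEulerOn (γ lam μ : ℝ) (u v : ℝ → ℝ → ℝ) (S : Set (ℝ × ℝ)) : Prop :=
  ∀ p ∈ S, pdt u p.1 p.2 - pdx v p.1 p.2 = 0 ∧
    pdt v p.1 p.2 + pdx (fun t x => pres γ (u t x)) p.1 p.2
      = -(lam / (1 + p.1) ^ μ) * v p.1 p.2

/-- `f` is `C¹` on `S ⊆ ℝ × ℝ`. -/
def IsC1On (f : ℝ → ℝ → ℝ) (S : Set (ℝ × ℝ)) : Prop :=
  ContDiffOn ℝ 1 (fun p : ℝ × ℝ => f p.1 p.2) S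

/-- `f` is `C²` on `S ⊆ ℝ × ℝ`. -/
def IsC2On (f : ℝ → ℝ → ℝ) (S : Set (ℝ × ℝ)) : Prop :=
  ContDiffOn ℝ 2 (fun p : ℝ × ℝ => f p.1 p.2) S

/-- `f` is `C¹_b` on `S ⊆ ℝ × ℝ`: `C¹` with `f` and its first partials bounded. -/
def IsC1bOn (f : ℝ → ℝ → ℝ) (S : Set (ℝ × ℝ)) : Prop :=
  IsC1On f S ∧ ∃ M : ℝ, ∀ p ∈ S, |f p.1 p.2| + |pdt f p.1 p.2| + |pdx f p.1 p.2| ≤ M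

/-- `f : ℝ → ℝ` is `C¹_b`. -/
def IsC1b (f : ℝ → ℝ) : Prop :=
  ContDiff ℝ 1 f ∧ ∃ M : ℝ, ∀ x, |f x| + |deriv f x| ≤ M

/-- The damping coefficient `λ/(2(1+t)^μ)`. -/
def damp (lam μ t : ℝ) : ℝ := lam / (2 * (1 + t) ^ μ)

/-- `A(t) = exp(∫₀ᵗ λ/(2(1+τ)^μ) dτ)`. -/
def Afun (lam μ t : ℝ) : ℝ := Real.exp (∫ τ in (0 : ℝ)..t, damp lam μ τ)

/-- `θ_γ(u)`. -/
def theta (γ u : ℝ) : ℝ :=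
  if γ = 3 then Real.log u else (4 / (3 - γ)) * (u ^ ((3 - γ) / 4) - 1)

open Filter Topology MeasureTheory

/-- Two integral curves of nearby vector fields on the line, the first field being Lipschitz in
space, stay close on either side of a reference time. -/
lemma sq_sub_add_sq_le_of_hasDerivAt {b b' : ℝ → ℝ → ℝ} {L η : ℝ}
    (hLip : ∀ t x y, |b t x - b t y| ≤ L * |x - y|) (hη : ∀ t x, |b' t x - b t x| ≤ η)
    {X Y : ℝ → ℝ} (hX : ∀ τ, HasDerivAt X (b τ (X τ)) τ)
    (hY : ∀ τ, HasDerivAt Y (b' τ (Y τ)) τ) (t τ : ℝ) :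
    (Y τ - X τ) ^ 2 + η ^ 2 ≤ ((Y t - X t) ^ 2 + η ^ 2) * exp ((2 * L + 1) * |τ - t|) := by
  have key : ∀ τ, |2 * (Y τ - X τ) * (b' τ (Y τ) - b τ (X τ))|
      ≤ (2 * L + 1) * ((Y τ - X τ) ^ 2 + η ^ 2) := by
    intro τ
    have h1 := hLip τ (Y τ) (X τ)
    have h2 := hη τ (Y τ)
    have hL : 0 ≤ L := by
      have := hLip 0 1 0
      have h3 := abs_nonneg (b 0 1 - b 0 0)
      norm_num at this
      linarith
    have h3 : |b' τ (Y τ) - b τ (X τ)| ≤ η + L * |Y τ - X τ| := by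
      calc _ = |(b' τ (Y τ) - b τ (Y τ)) + (b τ (Y τ) - b τ (X τ))| := by ring_nf
        _ ≤ _ := (abs_add_le _ _).trans (add_le_add h2 h1)
    rw [abs_mul, abs_mul, abs_two]
    have h4 := abs_nonneg (Y τ - X τ)
    rw [← sq_abs (Y τ - X τ)]
    have h5 := mul_le_mul_of_nonneg_left h3 h4
    nlinarith [sq_nonneg (|Y τ - X τ| - η), mul_nonneg hL (sq_nonneg η)]
  have hD : ∀ τ, HasDerivAt (fun τ => (Y τ - X τ) ^ 2 + η ^ 2)
      (2 * (Y τ - X τ) * (b' τ (Y τ) - b τ (X τ))) τ := by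
    intro τ
    have := (((hY τ).sub (hX τ)).pow 2).add_const (η ^ 2)
    simpa using this
  have hexp : ∀ K τ : ℝ, HasDerivAt (fun τ => exp (K * τ)) (exp (K * τ) * K) τ := by
    intro K τ
    simpa using ((hasDerivAt_id τ).const_mul K).exp
  rcases le_total τ t with h | h
  · have hm : Monotone (fun τ => ((Y τ - X τ) ^ 2 + η ^ 2) * exp ((2 * L + 1) * τ)) := by
      refine monotone_of_hasDerivAt_nonneg (fun τ => (hD τ).mul (hexp _ τ)) fun τ => ?_
      have := neg_le_of_abs_le (key τ)
      have he := exp_pos ((2 * L + 1) * τ)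
      simp only [Pi.zero_apply]
      nlinarith
    have := hm h
    rw [abs_of_nonpos (by linarith), show (2 * L + 1) * -(τ - t) = (2 * L + 1) * t - (2 * L + 1) * τ
      by ring, exp_sub, ← mul_div_assoc, le_div_iff₀ (exp_pos _)]
    exact this
  · have hm : Antitone (fun τ => ((Y τ - X τ) ^ 2 + η ^ 2) * exp (-(2 * L + 1) * τ)) := by
      refine antitone_of_hasDerivAt_nonpos (fun τ => (hD τ).mul (hexp _ τ)) fun τ => ?_
      have := le_of_abs_le (key τ)
      have he := exp_pos (-(2 * L + 1) * τ)
      simp only [Pi.zero_apply]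
      nlinarith
    have := hm h
    rw [abs_of_nonneg (by linarith), show (2 * L + 1) * (τ - t)
      = -(2 * L + 1) * t - (-(2 * L + 1) * τ) by ring, exp_sub, ← mul_div_assoc,
      le_div_iff₀ (exp_pos _)]
    exact this

/-- A bounded vector field on the line, Lipschitz in space, has global integral curves. -/
lemma exists_global_integralCurve {b : ℝ → ℝ → ℝ} {L B : ℝ}
    (hb : Continuous fun p : ℝ × ℝ => b p.1 p.2)
    (hLip : ∀ t x y, |b t x - b t y| ≤ L * |x - y|) (hB : ∀ t x, |b t x| ≤ B) (t x : ℝ) :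
    ∃ X : ℝ → ℝ, X t = x ∧ ∀ τ, HasDerivAt X (b τ (X τ)) τ := by
  have hB0 : 0 ≤ B := (abs_nonneg _).trans (hB 0 0)
  have hL : 0 ≤ L := by
    have := hLip 0 1 0
    have h3 := abs_nonneg (b 0 1 - b 0 0)
    norm_num at this
    linarith
  have loc : ∀ n : ℕ, ∃ X : ℝ → ℝ, X t = x ∧
      ∀ τ ∈ Ioo (t - (n + 1)) (t + (n + 1)), HasDerivAt X (b τ (X τ)) τ := by
    intro n
    have hn : (0 : ℝ) ≤ (n : ℝ) + 1 := by positivity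
    have hp : IsPicardLindelof b (tmin := t - (n + 1)) (tmax := t + (n + 1))
        ⟨t, by constructor <;> linarith⟩ x
        (⟨B * (n + 1), by positivity⟩ : NNReal) 0 ⟨B, hB0⟩ ⟨L, hL⟩ := by
      refine ⟨fun s _ => ?_, fun y _ => ?_, fun s _ y _ => hB s y, ?_⟩
      · exact (LipschitzWith.of_dist_le_mul fun y z => hLip s y z).lipschitzOnWith
      · exact (hb.comp (by fun_prop : Continuous fun s : ℝ => (s, y))).continuousOn
      · rw [show max (t + ((n : ℝ) + 1) - t) (t - (t - (n + 1))) = n + 1 by simp]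
        exact (sub_zero (B * ((n : ℝ) + 1))).symm.le
    obtain ⟨X, hX0, hX⟩ := hp.exists_eq_forall_mem_Icc_hasDerivWithinAt₀
    exact ⟨X, hX0, fun τ hτ => (hX τ (Ioo_subset_Icc_self hτ)).hasDerivAt
      (Icc_mem_nhds hτ.1 hτ.2)⟩
  choose X hX0 hX using loc
  have huniq : ∀ n m : ℕ, n ≤ m → EqOn (X n) (X m) (Ioo (t - (n + 1)) (t + (n + 1))) := by
    intro n m hnm
    have hnm' : (n : ℝ) ≤ m := by exact_mod_cast hnm
    have hn : (0 : ℝ) ≤ (n : ℝ) := by positivity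
    refine ODE_solution_unique_of_mem_Ioo (v := b) (K := ⟨L, hL⟩) (s := fun _ => univ) (t₀ := t)
      (fun s _ => (LipschitzWith.of_dist_le_mul fun y z => hLip s y z).lipschitzOnWith)
      ⟨by linarith, by linarith⟩ (fun s hs => ⟨hX n s hs, mem_univ _⟩)
      (fun s hs => ⟨hX m s ⟨by linarith [hs.1], by linarith [hs.2]⟩, mem_univ _⟩) ?_
    rw [hX0, hX0]
  refine ⟨fun τ => X ⌈|τ - t|⌉₊ τ, by simp [hX0], fun τ => ?_⟩
  set N := ⌈|τ - t|⌉₊ + 1 with hN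
  have hlt : |τ - t| < N := by
    have := Nat.le_ceil |τ - t|
    rw [hN]; push_cast; linarith
  have hev : (fun τ => X ⌈|τ - t|⌉₊ τ) =ᶠ[𝓝 τ] X N := by
    have : ∀ᶠ s in 𝓝 τ, |s - t| < N :=
      (by fun_prop : Continuous fun s => |s - t|).continuousAt.eventually_lt_const hlt
    filter_upwards [this] with s hs
    apply huniq _ _ (Nat.ceil_le.2 hs.le)
    have h1 := Nat.le_ceil |s - t|
    have h2 := neg_abs_le (s - t)
    have h3 := le_abs_self (s - t)
    constructor <;> linarith
  have h2 := neg_abs_le (τ - t)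
  have h3 := le_abs_self (τ - t)
  have := hX N τ ⟨by linarith, by linarith⟩
  rw [← hev.eq_of_nhds] at this
  exact this.congr_of_eventuallyEq hev

/-- A bounded continuous vector field on the line, uniformly Lipschitz in space. -/
structure LipField (b : ℝ → ℝ → ℝ) (L B : ℝ) : Prop where
  cont : Continuous fun p : ℝ × ℝ => b p.1 p.2
  lip : ∀ t x y, |b t x - b t y| ≤ L * |x - y|
  bdd : ∀ t x, |b t x| ≤ B

open Classical in
/-- The value at time `τ` of the integral curve of `b` through `x` at time `t`. -/
def flow (b : ℝ → ℝ → ℝ) (τ t x : ℝ) : ℝ :=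
  if h : ∃ X : ℝ → ℝ, X t = x ∧ ∀ τ, HasDerivAt X (b τ (X τ)) τ then h.choose τ else 0

namespace LipField

variable {b : ℝ → ℝ → ℝ} {L B : ℝ}

lemma flow_self (hb : LipField b L B) (t x : ℝ) : flow b t t x = x := by
  have h := exists_global_integralCurve hb.cont hb.lip hb.bdd t x
  rw [flow, dif_pos h, h.choose_spec.1]

lemma hasDerivAt_flow (hb : LipField b L B) (τ t x : ℝ) :
    HasDerivAt (fun τ => flow b τ t x) (b τ (flow b τ t x)) τ := by
  have h := exists_global_integralCurve hb.cont hb.lip hb.bdd t x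
  simp only [flow, dif_pos h]
  exact h.choose_spec.2 τ

lemma flow_flow (hb : LipField b L B) (σ τ t x : ℝ) :
    flow b σ τ (flow b τ t x) = flow b σ t x := by
  have := sq_sub_add_sq_le_of_hasDerivAt (η := 0) hb.lip (b' := b) (by simp)
    (fun s => hb.hasDerivAt_flow s t x) (fun s => hb.hasDerivAt_flow s τ (flow b τ t x)) τ σ
  rw [hb.flow_self] at this
  simp only [sub_self] at this
  have h2 := sq_nonneg (flow b σ τ (flow b τ t x) - flow b σ t x)
  have h3 : (flow b σ τ (flow b τ t x) - flow b σ t x) ^ 2 = 0 := by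
    apply le_antisymm _ h2
    simpa using this
  exact sub_eq_zero.1 (pow_eq_zero_iff two_ne_zero |>.1 h3)

lemma abs_flow_sub_le (hb : LipField b L B) (τ σ t x : ℝ) :
    |flow b τ t x - flow b σ t x| ≤ B * |τ - σ| := by
  have := Convex.norm_image_sub_le_of_norm_hasDerivWithin_le (s := univ) (C := B)
    (f := fun τ => flow b τ t x) (fun s _ => (hb.hasDerivAt_flow s t x).hasDerivWithinAt)
    (fun s _ => by simpa using hb.bdd s _) convex_univ (mem_univ σ) (mem_univ τ)
  simpa using this

/-- Integral curves depend continuously on the field, the times and the starting point. -/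
lemma tendsto_flow (hb : LipField b L B) {ι : Type*} {l : Filter ι} {b' : ι → ℝ → ℝ → ℝ}
    {L' : ℝ} (hb' : ∀ i, LipField (b' i) L' B) {η : ι → ℝ} (hη : ∀ i t x, |b' i t x - b t x| ≤ η i)
    (hη0 : Tendsto η l (𝓝 0)) {τ' t' x' : ι → ℝ} {τ t x : ℝ} (hτ : Tendsto τ' l (𝓝 τ))
    (ht : Tendsto t' l (𝓝 t)) (hx : Tendsto x' l (𝓝 x)) :
    Tendsto (fun i => flow (b' i) (τ' i) (t' i) (x' i)) l (𝓝 (flow b τ t x)) := by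
  have h1 : Tendsto (fun i => flow b (τ' i) t x) l (𝓝 (flow b τ t x)) :=
    (hb.hasDerivAt_flow τ t x).continuousAt.tendsto.comp hτ
  have h2 : Tendsto (fun i => ((B * |t - t' i| + |x' i - x|) ^ 2 + η i ^ 2) *
      exp ((2 * L + 1) * |τ' i - t|)) l
      (𝓝 (((B * |t - t| + |x - x|) ^ 2 + 0 ^ 2) * exp ((2 * L + 1) * |τ - t|))) := by
    have e1 := (((tendsto_const_nhds (x := t)).sub ht).abs.const_mul B).add
      (hx.sub (tendsto_const_nhds (x := x))).abs
    have e2 := ((hτ.sub (tendsto_const_nhds (x := t))).abs.const_mul (2 * L + 1)).rexp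
    exact ((e1.pow 2).add (hη0.pow 2)).mul e2
  simp only [sub_self, abs_zero, mul_zero, add_zero, ne_eq, OfNat.ofNat_ne_zero, not_false_eq_true,
    zero_pow, zero_mul] at h2
  have h3 : Tendsto (fun i => (flow (b' i) (τ' i) (t' i) (x' i) - flow b (τ' i) t x) ^ 2) l
      (𝓝 0) := by
    refine squeeze_zero (fun i => sq_nonneg _) (fun i => ?_) h2
    have := sq_sub_add_sq_le_of_hasDerivAt hb.lip (hη i)
      (fun s => hb.hasDerivAt_flow s t x) (fun s => (hb' i).hasDerivAt_flow s (t' i) (x' i)) t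
      (τ' i)
    rw [hb.flow_self] at this
    have h4 : |flow (b' i) t (t' i) (x' i) - x| ≤ B * |t - t' i| + |x' i - x| := by
      have h5 := (hb' i).abs_flow_sub_le t (t' i) (t' i) (x' i)
      rw [(hb' i).flow_self] at h5
      calc _ = |(flow (b' i) t (t' i) (x' i) - x' i) + (x' i - x)| := by ring_nf
        _ ≤ _ := (abs_add_le _ _).trans (by gcongr)
    have h6 : (flow (b' i) t (t' i) (x' i) - x) ^ 2 ≤ (B * |t - t' i| + |x' i - x|) ^ 2 := by
      rw [← sq_abs (flow (b' i) t (t' i) (x' i) - x)]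
      gcongr
    calc _ ≤ _ := (le_add_of_nonneg_right (sq_nonneg (η i))).trans this
      _ ≤ _ := by gcongr
  have h4 : Tendsto (fun i => flow (b' i) (τ' i) (t' i) (x' i) - flow b (τ' i) t x) l (𝓝 0) := by
    rw [tendsto_zero_iff_abs_tendsto_zero]
    have := h3.sqrt
    simpa [sqrt_sq_eq_abs, Function.comp_def] using this
  simpa using h4.add h1

@[fun_prop]
lemma continuous_flow (hb : LipField b L B) {Z : Type*} [TopologicalSpace Z] {τ t x : Z → ℝ}
    (hτ : Continuous τ) (ht : Continuous t) (hx : Continuous x) :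
    Continuous fun z => flow b (τ z) (t z) (x z) := by
  rw [continuous_iff_continuousAt]
  intro z
  exact hb.tendsto_flow (b' := fun _ => b) (η := fun _ => 0) (fun _ => hb) (by simp)
    tendsto_const_nhds hτ.continuousAt ht.continuousAt hx.continuousAt

end LipField

/-- A function of time and space, jointly continuous together with its spatial derivative. -/
structure SpaceC1 (f fx : ℝ → ℝ → ℝ) : Prop where
  cont : Continuous fun p : ℝ × ℝ => f p.1 p.2
  contx : Continuous fun p : ℝ × ℝ => fx p.1 p.2
  hasDerivAt : ∀ t x, HasDerivAt (f t) (fx t x) x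

/-- A bounded vector field on the line with continuous and bounded spatial derivative. -/
structure C1Field (b bx : ℝ → ℝ → ℝ) (L B : ℝ) : Prop extends SpaceC1 b bx where
  bddx : ∀ t x, |bx t x| ≤ L
  bdd : ∀ t x, |b t x| ≤ B

/-- Hadamard's factorization of spatial increments. -/
lemma SpaceC1.exists_factor {f fx : ℝ → ℝ → ℝ} (hf : SpaceC1 f fx) :
    ∃ m : ℝ → ℝ → ℝ → ℝ, (Continuous fun p : ℝ × ℝ × ℝ => m p.1 p.2.1 p.2.2) ∧
      (∀ s y z, f s z - f s y = m s y z * (z - y)) ∧ ∀ s y, m s y y = fx s y := by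
  refine ⟨fun s y z => ∫ θ in (0 : ℝ)..1, fx s (y + θ * (z - y)), ?_, fun s y z => ?_,
    fun s y => by simp⟩
  · have : Continuous (Function.uncurry fun (p : ℝ × ℝ × ℝ) (θ : ℝ) =>
        fx p.1 (p.2.1 + θ * (p.2.2 - p.2.1))) :=
      hf.contx.comp₂ (by fun_prop) (by fun_prop)
    exact intervalIntegral.continuous_parametric_intervalIntegral_of_continuous' this _ _
  · have h1 : ∀ θ ∈ uIcc (0 : ℝ) 1, HasDerivAt (fun θ => f s (y + θ * (z - y)))
        (fx s (y + θ * (z - y)) * (z - y)) θ := by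
      intro θ _
      have := (hf.hasDerivAt s (y + θ * (z - y))).comp θ
        (((hasDerivAt_id θ).mul_const (z - y)).const_add y)
      simpa [Function.comp_def] using this
    have hc : Continuous fun θ => fx s (y + θ * (z - y)) * (z - y) :=
      (hf.contx.comp₂ continuous_const (by fun_prop)).mul continuous_const
    have h2 := intervalIntegral.integral_eq_sub_of_hasDerivAt h1 (hc.intervalIntegrable _ _)
    rw [intervalIntegral.integral_mul_const] at h2
    simp only [one_mul, zero_mul, add_zero, add_sub_cancel] at h2
    exact h2.symm

lemma abs_sub_le_of_hasDerivAt {f f' : ℝ → ℝ} {L : ℝ} (h : ∀ x, HasDerivAt f (f' x) x)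
    (hL : ∀ x, |f' x| ≤ L) (x y : ℝ) : |f x - f y| ≤ L * |x - y| := by
  have := Convex.norm_image_sub_le_of_norm_hasDerivWithin_le (s := univ) (C := L)
    (f := f) (fun s _ => (h s).hasDerivWithinAt)
    (fun s _ => by simpa using hL s) convex_univ (mem_univ y) (mem_univ x)
  simpa using this

/-- Differentiation under the integral sign for jointly continuous integrands. -/
lemma hasDerivAt_intervalIntegral_of_continuous {F F' : ℝ → ℝ → ℝ}
    (hF : Continuous fun p : ℝ × ℝ => F p.1 p.2) (hF' : Continuous fun p : ℝ × ℝ => F' p.1 p.2)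
    (h : ∀ x s, HasDerivAt (fun x => F x s) (F' x s) x) (c d x₀ : ℝ) :
    HasDerivAt (fun x => ∫ s in c..d, F x s) (∫ s in c..d, F' x₀ s) x₀ := by
  obtain ⟨C, hC⟩ := ((isCompact_closedBall x₀ 1).prod
    (isCompact_uIcc (a := c) (b := d))).exists_bound_of_continuousOn
    hF'.continuousOn
  refine (intervalIntegral.hasDerivAt_integral_of_dominated_loc_of_deriv_le (F' := F')
    (bound := fun _ => C) (Metric.closedBall_mem_nhds x₀ one_pos) ?_ ?_ ?_ ?_ ?_ ?_).2
  · exact Eventually.of_forall fun x =>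
      (hF.comp (by fun_prop : Continuous fun s => (x, s))).aestronglyMeasurable
  · exact (hF.comp (by fun_prop : Continuous fun s => (x₀, s))).intervalIntegrable _ _
  · exact (hF'.comp (by fun_prop : Continuous fun s => (x₀, s))).aestronglyMeasurable
  · exact Eventually.of_forall fun s hs x hx => hC (x, s) ⟨hx, uIoc_subset_uIcc hs⟩
  · exact continuous_const.intervalIntegrable _ _
  · exact Eventually.of_forall fun s _ x _ => h x s

/-- Carathéodory's criterion for differentiability. -/
lemma hasDerivAt_of_sub_eq_mul {f g : ℝ → ℝ} {x : ℝ} (h : ∀ y, f y - f x = (y - x) * g y)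
    (hg : ContinuousAt g x) : HasDerivAt f (g x) x := by
  rw [hasDerivAt_iff_tendsto_slope]
  refine (hg.tendsto.mono_left nhdsWithin_le_nhds).congr' ?_
  filter_upwards [self_mem_nhdsWithin] with y hy
  rw [slope_def_field, h, mul_div_cancel_left₀ _ (sub_ne_zero.2 hy)]

/-- The spatial derivative of the flow. -/
def jac (b bx : ℝ → ℝ → ℝ) (τ t x : ℝ) : ℝ := exp (∫ s in t..τ, bx s (flow b s t x))

lemma jac_pos (b bx : ℝ → ℝ → ℝ) (τ t x : ℝ) : 0 < jac b bx τ t x := exp_pos _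

namespace C1Field

variable {b bx : ℝ → ℝ → ℝ} {L B : ℝ}

lemma lipField (hb : C1Field b bx L B) : LipField b L B :=
  ⟨hb.cont, fun t => abs_sub_le_of_hasDerivAt (hb.hasDerivAt t) (hb.bddx t), hb.bdd⟩

lemma continuous_bx_flow (hb : C1Field b bx L B) {Z : Type*} [TopologicalSpace Z] {s τ t x : Z → ℝ}
    (hs : Continuous s)
    (hτ : Continuous τ) (ht : Continuous t) (hx : Continuous x) :
    Continuous fun z => bx (s z) (flow b (τ z) (t z) (x z)) :=
  hb.contx.comp₂ hs (hb.lipField.continuous_flow hτ ht hx)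

lemma continuous_jac (hb : C1Field b bx L B) {Z : Type*} [TopologicalSpace Z] {τ t x : Z → ℝ}
    (hτ : Continuous τ) (ht : Continuous t) (hx : Continuous x) :
    Continuous fun z => jac b bx (τ z) (t z) (x z) := by
  have h : Continuous fun p : ℝ × ℝ × ℝ => jac b bx p.1 p.2.1 p.2.2 := by
    unfold jac
    have e : ∀ p : ℝ × ℝ × ℝ, ∫ s in p.2.1..p.1, bx s (flow b s p.2.1 p.2.2) =
        (∫ s in (0 : ℝ)..p.1, bx s (flow b s p.2.1 p.2.2)) -
          ∫ s in (0 : ℝ)..p.2.1, bx s (flow b s p.2.1 p.2.2) := by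
      intro p
      have hc : Continuous fun s => bx s (flow b s p.2.1 p.2.2) :=
        hb.continuous_bx_flow continuous_id continuous_id continuous_const continuous_const
      rw [intervalIntegral.integral_interval_sub_left] <;> exact hc.intervalIntegrable _ _
    simp_rw [e]
    have hc : Continuous (Function.uncurry
        fun (p : ℝ × ℝ × ℝ) (s : ℝ) => bx s (flow b s p.2.1 p.2.2)) :=
      hb.continuous_bx_flow (by fun_prop) (by fun_prop) (by fun_prop) (by fun_prop)
    exact continuous_exp.comp
      ((intervalIntegral.continuous_parametric_intervalIntegral_of_continuous hc continuous_fst).sub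
      (intervalIntegral.continuous_parametric_intervalIntegral_of_continuous hc
        (continuous_fst.comp continuous_snd)))
  exact h.comp (hτ.prodMk (ht.prodMk hx))

lemma hasDerivAt_flow_space (hb : C1Field b bx L B) (τ t x : ℝ) :
    HasDerivAt (fun x => flow b τ t x) (jac b bx τ t x) x := by
  obtain ⟨m, hmc, hme, hdiag⟩ := hb.toSpaceC1.exists_factor
  set G : ℝ → ℝ → ℝ := fun y s => m s (flow b s t x) (flow b s t y) with hG
  have hGc : Continuous fun p : ℝ × ℝ => G p.1 p.2 := by
    have hf := hb.lipField
    exact hmc.comp (continuous_snd.prodMk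
      ((hf.continuous_flow continuous_snd continuous_const continuous_const).prodMk
        (hf.continuous_flow continuous_snd continuous_const continuous_fst)))
  have hlin : ∀ y, flow b τ t y - flow b τ t x = (y - x) * exp (∫ s in t..τ, G y s) := by
    intro y
    have hGy : Continuous (G y) := hGc.comp₂ continuous_const continuous_id
    have hI : ∀ s, HasDerivAt (fun s => exp (-∫ r in t..s, G y r))
        (exp (-∫ r in t..s, G y r) * -G y s) s := fun s =>
      (hGy.integral_hasStrictDerivAt t s).hasDerivAt.neg.exp
    have hD : ∀ s, HasDerivAt (fun s => (flow b s t y - flow b s t x) *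
        exp (-∫ r in t..s, G y r)) 0 s := by
      intro s
      have := ((hb.lipField.hasDerivAt_flow s t y).sub (hb.lipField.hasDerivAt_flow s t x)).mul
        (hI s)
      refine this.congr_deriv ?_
      simp only [Pi.sub_apply, hme s, hG]
      ring
    have hconst := is_const_of_deriv_eq_zero (fun s => (hD s).differentiableAt)
      (fun s => (hD s).deriv) τ t
    simp only [hb.lipField.flow_self, intervalIntegral.integral_same, neg_zero, exp_zero, mul_one,
      exp_neg] at hconst
    rw [← hconst, mul_assoc, inv_mul_cancel₀ (exp_pos _).ne', mul_one]
  have hcont : Continuous fun y => exp (∫ s in t..τ, G y s) :=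
    continuous_exp.comp
      (intervalIntegral.continuous_parametric_intervalIntegral_of_continuous' hGc t τ)
  have := hasDerivAt_of_sub_eq_mul (x := x) hlin hcont.continuousAt
  have he : exp (∫ s in t..τ, G x s) = jac b bx τ t x := by simp only [hG, hdiag, jac]
  rwa [he] at this

lemma jac_flow (hb : C1Field b bx L B) (σ τ t x : ℝ) :
    jac b bx σ τ (flow b τ t x) * jac b bx τ t x = jac b bx σ t x := by
  have hc : Continuous fun s => bx s (flow b s t x) :=
    hb.continuous_bx_flow continuous_id continuous_id continuous_const continuous_const
  simp only [jac, hb.lipField.flow_flow, ← exp_add]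
  rw [add_comm, intervalIntegral.integral_add_adjacent_intervals] <;>
    exact hc.intervalIntegrable _ _

lemma hasDerivAt_jac (hb : C1Field b bx L B) (τ t x : ℝ) :
    HasDerivAt (fun τ => jac b bx τ t x) (bx τ (flow b τ t x) * jac b bx τ t x) τ := by
  have hc : Continuous fun s => bx s (flow b s t x) :=
    hb.continuous_bx_flow continuous_id continuous_id continuous_const continuous_const
  have := (hc.integral_hasStrictDerivAt t τ).hasDerivAt.exp
  rwa [mul_comm] at this

end C1Field

lemma SpaceC1.hasDerivAt_sub_along {f fx : ℝ → ℝ → ℝ} (hf : SpaceC1 f fx) {X : ℝ → ℝ} {X' τ : ℝ}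
    (hX : HasDerivAt X X' τ) :
    HasDerivAt (fun s => f s (X s) - f s (X τ)) (fx τ (X τ) * X') τ := by
  obtain ⟨m, hmc, hme, hdiag⟩ := hf.exists_factor
  have h1 : ∀ s, (f s (X s) - f s (X τ)) - (f τ (X τ) - f τ (X τ))
      = (s - τ) * (m s (X τ) (X s) * dslope X τ s) := by
    intro s
    have := sub_smul_dslope X τ s
    simp only [smul_eq_mul] at this
    rw [sub_self, sub_zero, hme, ← this]
    ring
  have h2 : ContinuousAt (fun s => m s (X τ) (X s) * dslope X τ s) τ := by
    refine ContinuousAt.mul ?_ (continuousAt_dslope_same.2 hX.differentiableAt)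
    exact ContinuousAt.comp (f := fun s => (s, X τ, X s)) hmc.continuousAt
      (continuousAt_id.prodMk (continuousAt_const.prodMk hX.continuousAt))
  have := hasDerivAt_of_sub_eq_mul h1 h2
  rwa [hdiag, dslope_same, hX.deriv] at this

/-- Chain rule along a curve. -/
lemma SpaceC1.hasDerivAt_along {f fx : ℝ → ℝ → ℝ} (hf : SpaceC1 f fx) {X : ℝ → ℝ} {X' τ g : ℝ}
    (hX : HasDerivAt X X' τ) (ht : HasDerivAt (fun s => f s (X τ)) g τ) :
    HasDerivAt (fun s => f s (X s)) (g + fx τ (X τ) * X') τ := by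
  exact (ht.add (hf.hasDerivAt_sub_along hX)).congr_of_eventuallyEq
    (Eventually.of_forall fun s => by simp)

lemma SpaceC1.hasDerivAt_of_along {f fx : ℝ → ℝ → ℝ} (hf : SpaceC1 f fx) {X : ℝ → ℝ}
    {X' τ g : ℝ} (hX : HasDerivAt X X' τ) (ht : HasDerivAt (fun s => f s (X s)) g τ) :
    HasDerivAt (fun s => f s (X τ)) (g - fx τ (X τ) * X') τ := by
  exact (ht.sub (hf.hasDerivAt_sub_along hX)).congr_of_eventuallyEq
    (Eventually.of_forall fun s => by simp)

/-- The solution of `y_t + b y_x = -a f` with initial value `w₀`. -/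
def tr (b : ℝ → ℝ → ℝ) (a : ℝ → ℝ) (f : ℝ → ℝ → ℝ) (w₀ : ℝ → ℝ) (t x : ℝ) : ℝ :=
  w₀ (flow b 0 t x) - ∫ s in (0 : ℝ)..t, a s * f s (flow b s t x)

/-- The spatial derivative of `tr b a f w₀`. -/
def trx (b bx : ℝ → ℝ → ℝ) (a : ℝ → ℝ) (fx : ℝ → ℝ → ℝ) (w₀' : ℝ → ℝ) (t x : ℝ) : ℝ :=
  w₀' (flow b 0 t x) * jac b bx 0 t x -
    ∫ s in (0 : ℝ)..t, a s * fx s (flow b s t x) * jac b bx s t x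

namespace C1Field

variable {b bx f fx : ℝ → ℝ → ℝ} {L B : ℝ} {a w₀ w₀' : ℝ → ℝ}

lemma tr_zero (hb : C1Field b bx L B) (x : ℝ) : tr b a f w₀ 0 x = w₀ x := by
  simp [tr, hb.lipField.flow_self]

lemma tr_flow (hb : C1Field b bx L B) (τ t x : ℝ) : tr b a f w₀ τ (flow b τ t x) =
    w₀ (flow b 0 t x) - ∫ s in (0 : ℝ)..τ, a s * f s (flow b s t x) := by
  simp only [tr, hb.lipField.flow_flow]

lemma trx_flow_mul_jac (hb : C1Field b bx L B) (τ t x : ℝ) :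
    trx b bx a fx w₀' τ (flow b τ t x) * jac b bx τ t x = w₀' (flow b 0 t x) * jac b bx 0 t x -
      ∫ s in (0 : ℝ)..τ, a s * fx s (flow b s t x) * jac b bx s t x := by
  simp only [trx, hb.lipField.flow_flow, sub_mul, ← intervalIntegral.integral_mul_const]
  simp only [mul_assoc, hb.jac_flow]

lemma spaceC1_tr (hb : C1Field b bx L B) (ha : Continuous a) (hf : SpaceC1 f fx)
    (hw : ∀ x, HasDerivAt w₀ (w₀' x) x) (hw' : Continuous w₀') :
    SpaceC1 (tr b a f w₀) (trx b bx a fx w₀') := by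
  have hw0 : Continuous w₀ := continuous_iff_continuousAt.2 fun x => (hw x).continuousAt
  have hF : Continuous (Function.uncurry fun (p : ℝ × ℝ) s => a s * f s (flow b s p.1 p.2)) :=
    (ha.comp continuous_snd).mul (hf.cont.comp₂ continuous_snd
      (hb.lipField.continuous_flow (by fun_prop) (by fun_prop) (by fun_prop)))
  have hF' : Continuous (Function.uncurry fun (p : ℝ × ℝ) s =>
      a s * fx s (flow b s p.1 p.2) * jac b bx s p.1 p.2) :=
    ((ha.comp continuous_snd).mul (hf.contx.comp₂ continuous_snd
      (hb.lipField.continuous_flow (by fun_prop) (by fun_prop) (by fun_prop)))).mul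
      (hb.continuous_jac (by fun_prop) (by fun_prop) (by fun_prop))
  have h0 : Continuous fun p : ℝ × ℝ => flow b 0 p.1 p.2 :=
    hb.lipField.continuous_flow (by fun_prop) (by fun_prop) (by fun_prop)
  refine ⟨?_, ?_, fun t x => ?_⟩
  · exact (hw0.comp h0).sub
      (intervalIntegral.continuous_parametric_intervalIntegral_of_continuous hF continuous_fst)
  · exact ((hw'.comp h0).mul
      (hb.continuous_jac (by fun_prop) (by fun_prop) (by fun_prop))).sub
      (intervalIntegral.continuous_parametric_intervalIntegral_of_continuous hF' continuous_fst)
  · refine ((hw _).comp x (hb.hasDerivAt_flow_space 0 t x)).sub ?_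
    refine hasDerivAt_intervalIntegral_of_continuous (F := fun x s => a s * f s (flow b s t x))
      (F' := fun x s => a s * fx s (flow b s t x) * jac b bx s t x) ?_ ?_ ?_ 0 t x
    · exact hF.comp (by fun_prop : Continuous fun p : ℝ × ℝ => ((t, p.1), p.2))
    · exact hF'.comp (by fun_prop : Continuous fun p : ℝ × ℝ => ((t, p.1), p.2))
    · intro x s
      rw [mul_assoc]
      exact ((hf.hasDerivAt s _).comp x (hb.hasDerivAt_flow_space s t x)).const_mul (a s)

lemma hasDerivAt_tr_time (hb : C1Field b bx L B) (ha : Continuous a) (hf : SpaceC1 f fx)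
    (hw : ∀ x, HasDerivAt w₀ (w₀' x) x) (hw' : Continuous w₀') (t x : ℝ) :
    HasDerivAt (fun t => tr b a f w₀ t x)
      (-(a t * f t x) - trx b bx a fx w₀' t x * b t x) t := by
  have hc : Continuous fun s => a s * f s (flow b s t x) :=
    ha.mul (hf.cont.comp₂ continuous_id
      (hb.lipField.continuous_flow continuous_id continuous_const continuous_const))
  have h1 : HasDerivAt (fun s => tr b a f w₀ s (flow b s t x))
      (-(a t * f t (flow b t t x))) t := by
    simp only [hb.tr_flow]
    exact (hc.integral_hasStrictDerivAt 0 t).hasDerivAt.const_sub _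
  have h2 := (hb.spaceC1_tr ha hf hw hw').hasDerivAt_of_along
    (hb.lipField.hasDerivAt_flow t t x) h1
  simpa only [hb.lipField.flow_self] using h2

/-- The spatial derivative of `tr b a f w₀` solves the differentiated equation. -/
lemma trx_eq (hb : C1Field b bx L B) (ha : Continuous a) (hf : SpaceC1 f fx)
    (hw : ∀ x, HasDerivAt w₀ (w₀' x) x) (hw' : Continuous w₀') (t x : ℝ) :
    trx b bx a fx w₀' t x = w₀' (flow b 0 t x) - ∫ s in (0 : ℝ)..t,
      (bx s (flow b s t x) * trx b bx a fx w₀' s (flow b s t x) +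
        a s * fx s (flow b s t x)) := by
  have hfl : Continuous fun s => flow b s t x :=
    hb.lipField.continuous_flow continuous_id continuous_const continuous_const
  have hj : Continuous fun s => jac b bx s t x :=
    hb.continuous_jac continuous_id continuous_const continuous_const
  have hc : Continuous fun s => a s * fx s (flow b s t x) * jac b bx s t x :=
    (ha.mul (hf.contx.comp₂ continuous_id hfl)).mul hj
  have hV : ∀ s, trx b bx a fx w₀' s (flow b s t x) =
      (w₀' (flow b 0 t x) * jac b bx 0 t x -
      ∫ s in (0 : ℝ)..s, a s * fx s (flow b s t x) * jac b bx s t x) / jac b bx s t x :=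
    fun s => eq_div_of_mul_eq (jac_pos b bx s t x).ne' (hb.trx_flow_mul_jac s t x)
  have hD : ∀ s, HasDerivAt (fun s => trx b bx a fx w₀' s (flow b s t x))
      (-(bx s (flow b s t x) * trx b bx a fx w₀' s (flow b s t x) +
        a s * fx s (flow b s t x))) s := by
    intro s
    have hp := (jac_pos b bx s t x).ne'
    have := (((hc.integral_hasStrictDerivAt 0 s).hasDerivAt.const_sub
      (w₀' (flow b 0 t x) * jac b bx 0 t x))).div (hb.hasDerivAt_jac s t x) hp
    simp only [hV]
    refine this.congr_deriv ?_
    field_simp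
    ring
  have hcc : Continuous fun s => -(bx s (flow b s t x) * trx b bx a fx w₀' s (flow b s t x) +
        a s * fx s (flow b s t x)) :=
    (((hb.contx.comp₂ continuous_id hfl).mul
      ((hb.spaceC1_tr ha hf hw hw').contx.comp₂ continuous_id hfl)).add
      (ha.mul (hf.contx.comp₂ continuous_id hfl))).neg
  have := intervalIntegral.integral_eq_sub_of_hasDerivAt (a := 0) (b := t) (fun s _ => hD s)
    (hcc.intervalIntegrable _ _)
  rw [intervalIntegral.integral_neg, hb.lipField.flow_self, hV 0] at this
  simp only [intervalIntegral.integral_same, sub_zero,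
    mul_div_cancel_right₀ _ (jac_pos b bx 0 t x).ne'] at this
  linarith

end C1Field

/-- A weight `A` growing from `A 0 = 1` with derivative `a`, such that `a'` and `a² / A` are
dominated by an integrable function `H`. -/
structure Damping (A a a' H : ℝ → ℝ) (H₀ : ℝ) : Prop where
  contA : Continuous A
  conta : Continuous a
  conta' : Continuous a'
  contH : Continuous H
  A_zero : A 0 = 1
  one_le : ∀ t, 1 ≤ A t
  hasDerivAt_A : ∀ t, 0 < t → HasDerivAt A (a t) t
  hasDerivAt_a : ∀ t, 0 < t → HasDerivAt a (a' t) t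
  nonneg : ∀ t, 0 ≤ a t
  le_one : ∀ t, a t ≤ 1
  abs_le : ∀ t, |a' t| ≤ H t
  sq_le : ∀ t, a t * (a t / A t) ≤ H t
  int_le : ∀ t, 0 ≤ t → ∫ s in (0 : ℝ)..t, H s ≤ H₀

/-- A bounded function on `[0, T] × ℝ` (extended to all times) whose first derivatives decay
like `1 / A`. -/
structure Decaying (T : ℝ) (A : ℝ → ℝ) (M N V : ℝ) (w wx wt : ℝ → ℝ → ℝ) : Prop
    extends SpaceC1 w wx where
  contt : Continuous fun p : ℝ × ℝ => wt p.1 p.2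
  time : ∀ t ∈ Ioo 0 T, ∀ x, HasDerivAt (fun t => w t x) (wt t x) t
  bdd : ∀ t x, |w t x| ≤ M
  bddx : ∀ t x, |wx t x| ≤ N
  decayx : ∀ t ∈ Icc 0 T, ∀ x, |wx t x| ≤ N / A t
  decayt : ∀ t ∈ Ioo 0 T, ∀ x, |wt t x| ≤ V * N / A t

lemma Damping.pos {A a a' H : ℝ → ℝ} {H₀ : ℝ} (D : Damping A a a' H H₀) (t : ℝ) : 0 < A t :=
  zero_lt_one.trans_le (D.one_le t)

lemma Damping.continuous_inv {A a a' H : ℝ → ℝ} {H₀ : ℝ} (D : Damping A a a' H H₀) :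
    Continuous fun t => 1 / A t :=
  continuous_const.div D.contA fun t => (D.pos t).ne'

lemma Decaying.c1Field {T M N V σ : ℝ} {A : ℝ → ℝ} {w wx wt : ℝ → ℝ → ℝ}
    (hw : Decaying T A M N V w wx wt) (hσ : |σ| = 1) :
    C1Field (fun t x => σ * w t x) (fun t x => σ * wx t x) N M where
  cont := continuous_const.mul hw.cont
  contx := continuous_const.mul hw.contx
  hasDerivAt t x := (hw.hasDerivAt t x).const_mul σ
  bddx t x := by rw [abs_mul, hσ, one_mul]; exact hw.bddx t x
  bdd t x := by rw [abs_mul, hσ, one_mul]; exact hw.bdd t x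

lemma abs_integral_le_of_hasDerivAt_add {Y F R g : ℝ → ℝ} {t : ℝ} (ht : 0 ≤ t)
    (hY : Continuous Y) (hF : Continuous F) (hR : Continuous R) (hg : Continuous g)
    (hD : ∀ s ∈ Ioo 0 t, HasDerivAt Y (F s + R s) s) (hb : ∀ s ∈ Ioo 0 t, |R s| ≤ g s) :
    |∫ s in (0 : ℝ)..t, F s| ≤ |Y t| + |Y 0| + ∫ s in (0 : ℝ)..t, g s := by
  have h1 := intervalIntegral.integral_eq_sub_of_hasDerivAt_of_le ht hY.continuousOn hD
    ((hF.add hR).intervalIntegrable _ _)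
  rw [intervalIntegral.integral_add (hF.intervalIntegrable _ _) (hR.intervalIntegrable _ _)] at h1
  have h2 : ‖∫ s in (0 : ℝ)..t, R s‖ ≤ ∫ s in (0 : ℝ)..t, g s := by
    refine intervalIntegral.norm_integral_le_of_norm_le ht ?_ (hg.intervalIntegrable _ _)
    have : ∀ᵐ s : ℝ, s ≠ t := by simp [ae_iff, measure_singleton]
    filter_upwards [this] with s hs hst
    exact hb s ⟨hst.1, lt_of_le_of_ne hst.2 hs⟩
  rw [Real.norm_eq_abs] at h2
  have h3 : ∫ s in (0 : ℝ)..t, F s = Y t - Y 0 - ∫ s in (0 : ℝ)..t, R s := by linarith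
  rw [h3]
  exact (abs_sub _ _).trans (add_le_add (abs_sub _ _) h2)

/-- The derivative of a Riemann invariant stays bounded after multiplication by `A`: the source
`a fx` is, up to small terms, a derivative along the characteristics. -/
lemma abs_trx_le {A a a' H : ℝ → ℝ} {H₀ T c₀ c₁ K N N₀ M V σ t : ℝ}
    (D : Damping A a a' H H₀)
    {s₁ s₁x s₁t s₂ s₂x s₂t f fx h : ℝ → ℝ → ℝ} {w₀' : ℝ → ℝ}
    (h₁ : Decaying T A c₁ (K * N) V s₁ s₁x s₁t) (h₂ : Decaying T A c₁ (K * N) V s₂ s₂x s₂t)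
    (hc₀ : 0 < c₀) (hl₁ : ∀ t x, c₀ ≤ s₁ t x) (hl₂ : ∀ t x, c₀ ≤ s₂ t x)
    (hf : SpaceC1 f fx) (hh : Continuous fun p : ℝ × ℝ => h p.1 p.2)
    (hft : ∀ s ∈ Ioo 0 T, ∀ x, HasDerivAt (fun s => f s x)
      (σ * s₂ s x * fx s x - a s / A s * (f s x + h s x)) s)
    (hfM : ∀ t x, |f t x| ≤ M) (hhM : ∀ t x, |h t x| ≤ M) (hw₀ : ∀ x, |w₀' x| ≤ N₀)
    (hσ : |σ| = 1) (hK : 0 ≤ K) (hN : 0 ≤ N) (hV : 0 ≤ V)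
    (h_int : 2 * K * N * (V + c₁ + 1) * ∫ s in (0 : ℝ)..T, 1 / A s ≤ 1) (ht : t ∈ Icc 0 T) (x : ℝ) :
    |trx (fun t x => σ * s₁ t x) (fun t x => σ * s₁x t x) a fx w₀' t x| ≤
      exp 1 * (N₀ + M / (2 * c₀) * (3 + 3 * H₀ + 1 / (2 * c₀))) := by
  have hσ2 : σ * σ = 1 := by rw [← abs_mul_abs_self, hσ, one_mul]
  have hb := h₁.c1Field hσ
  set b : ℝ → ℝ → ℝ := fun t x => σ * s₁ t x with hbdef
  set bx : ℝ → ℝ → ℝ := fun t x => σ * s₁x t x with hbxdef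
  have hM : 0 ≤ M := (abs_nonneg _).trans (hfM 0 0)
  have hc₁ : 0 ≤ c₁ := (abs_nonneg _).trans (h₁.bdd 0 0)
  have hiA := D.continuous_inv
  have hiApos : ∀ s, 0 < 1 / A s := fun s => one_div_pos.2 (D.pos s)
  set I := ∫ s in (0 : ℝ)..T, 1 / A s with hI
  have hT : 0 ≤ T := ht.1.trans ht.2
  have hI0 : 0 ≤ I := intervalIntegral.integral_nonneg hT fun s _ => (hiApos s).le
  have hsub : ∀ s ∈ Icc 0 t, ∫ r in s..t, 1 / A r ≤ I := by
    intro s hs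
    refine intervalIntegral.integral_mono_interval hs.1 hs.2 ht.2
      (Eventually.of_forall fun r => (hiApos r).le) (hiA.intervalIntegrable _ _)
  have hKNI : K * N * I ≤ 1 := by
    have h1 : 0 ≤ K * N * I := by positivity
    nlinarith
  set X : ℝ → ℝ := fun s => flow b s t x with hX
  have hXc : Continuous X :=
    hb.lipField.continuous_flow continuous_id continuous_const continuous_const
  have hXd : ∀ s, HasDerivAt X (b s (X s)) s := fun s => hb.lipField.hasDerivAt_flow s t x
  set J : ℝ → ℝ := fun s => jac b bx s t x with hJ
  have hJc : Continuous J := hb.continuous_jac continuous_id continuous_const continuous_const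
  have hJd : ∀ s, HasDerivAt J (bx s (X s) * J s) s := fun s => hb.hasDerivAt_jac s t x
  have hJ0 : ∀ s, 0 < J s := fun s => jac_pos _ _ _ _ _
  have hJe : ∀ s ∈ Icc 0 t, J s ≤ exp 1 := by
    intro s hs
    refine exp_le_exp.2 ?_
    rw [intervalIntegral.integral_symm]
    have h1 : ‖∫ r in s..t, bx r (X r)‖ ≤ ∫ r in s..t, K * N * (1 / A r) := by
      refine intervalIntegral.norm_integral_le_of_norm_le hs.2
        (Eventually.of_forall fun r hr => ?_)
        ((continuous_const.mul hiA).intervalIntegrable _ _)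
      rw [Real.norm_eq_abs, hbxdef, abs_mul, hσ, one_mul, mul_one_div]
      exact h₁.decayx r ⟨hs.1.trans hr.1.le, hr.2.trans ht.2⟩ _
    have h3 : ∫ r in s..t, K * N * (1 / A r) = K * N * ∫ r in s..t, 1 / A r :=
      intervalIntegral.integral_const_mul _ _
    rw [h3, Real.norm_eq_abs] at h1
    have h2 := mul_le_mul_of_nonneg_left (hsub s hs) (mul_nonneg hK hN)
    have h4 := neg_le_of_abs_le h1
    change -∫ r in s..t, bx r (X r) ≤ 1
    linarith
  -- the difference of the two characteristic speeds along `X`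
  set d : ℝ → ℝ := fun s => s₁ s (X s) + s₂ s (X s) with hd
  set d' : ℝ → ℝ := fun s => (s₁t s (X s) + s₁x s (X s) * b s (X s)) +
    (s₂t s (X s) + s₂x s (X s) * b s (X s)) with hd'
  have cX : ∀ {g : ℝ → ℝ → ℝ}, (Continuous fun p : ℝ × ℝ => g p.1 p.2) →
    Continuous fun s => g s (X s) := fun hg => hg.comp₂ continuous_id hXc
  have hdc : Continuous d := (cX h₁.cont).add (cX h₂.cont)
  have hd'c : Continuous d' := ((cX h₁.contt).add ((cX h₁.contx).mul (cX hb.cont))).add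
    ((cX h₂.contt).add ((cX h₂.contx).mul (cX hb.cont)))
  have hdl : ∀ s, 2 * c₀ ≤ d s := fun s => by
    have := hl₁ s (X s); have := hl₂ s (X s); simp only [hd]; linarith
  have hdpos : ∀ s, 0 < d s := fun s => (by positivity : 0 < 2 * c₀).trans_le (hdl s)
  have hdd : ∀ s ∈ Ioo 0 t, HasDerivAt d (d' s) s := by
    intro s hs
    have hs' : s ∈ Ioo 0 T := ⟨hs.1, hs.2.trans_le ht.2⟩
    exact (h₁.hasDerivAt_along (hXd s) (h₁.time s hs' _)).add
      (h₂.hasDerivAt_along (hXd s) (h₂.time s hs' _))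
  have hd'b : ∀ s ∈ Ioo 0 t, |d' s| ≤ 2 * K * N * (V + c₁) * (1 / A s) := by
    intro s hs
    have hs' : s ∈ Ioo 0 T := ⟨hs.1, hs.2.trans_le ht.2⟩
    have hbs := hb.bdd s (X s)
    have e : ∀ {u ux ut : ℝ → ℝ → ℝ}, Decaying T A c₁ (K * N) V u ux ut →
        |ut s (X s) + ux s (X s) * b s (X s)| ≤ K * N * (V + c₁) * (1 / A s) := by
      intro u ux ut hu
      have e1 := hu.decayt s hs' (X s)
      have e2 := hu.decayx s (Ioo_subset_Icc_self hs') (X s)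
      calc _ ≤ |ut s (X s)| + |ux s (X s) * b s (X s)| := abs_add_le _ _
        _ ≤ V * (K * N) / A s + K * N / A s * c₁ := by
          rw [abs_mul]; gcongr
          exact (abs_nonneg _).trans e2
        _ = _ := by ring
    calc |d' s| ≤ _ := (abs_add_le _ _).trans (add_le_add (e h₁) (e h₂))
      _ = _ := by ring
  -- integration by parts
  set Y : ℝ → ℝ := fun s => a s * J s / d s * (σ * f s (X s)) with hY
  set R : ℝ → ℝ := fun s => ((a' s * J s + a s * (bx s (X s) * J s)) * d s - a s * J s * d' s) /
      d s ^ 2 * (σ * f s (X s))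
    - a s * J s / d s * (σ * (a s / A s * (f s (X s) + h s (X s)))) with hR
  have hYb : ∀ s ∈ Icc 0 t, |Y s| ≤ exp 1 * M / (2 * c₀) := by
    intro s hs
    have e1 : |σ * f s (X s)| ≤ M := by rw [abs_mul, hσ, one_mul]; exact hfM _ _
    have e2 : |a s * J s / d s| ≤ exp 1 / (2 * c₀) := by
      rw [abs_of_nonneg (div_nonneg (mul_nonneg (D.nonneg s) (hJ0 s).le) (hdpos s).le)]
      have := D.nonneg s
      gcongr
      · calc a s * J s ≤ 1 * exp 1 := by
              gcongr
              · exact (hJ0 s).le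
              · exact D.le_one s
              · exact hJe s hs
          _ = _ := one_mul _
      · exact hdl s
    calc |Y s| = |a s * J s / d s| * |σ * f s (X s)| := abs_mul _ _
      _ ≤ exp 1 / (2 * c₀) * M := by gcongr
      _ = _ := by ring
  have hYd : ∀ s ∈ Ioo 0 t, HasDerivAt Y (a s * fx s (X s) * J s + R s) s := by
    intro s hs
    have hs' : s ∈ Ioo 0 T := ⟨hs.1, hs.2.trans_le ht.2⟩
    have e1 := hf.hasDerivAt_along (hXd s) (hft s hs' _)
    have e2 := (((D.hasDerivAt_a s hs.1).mul (hJd s)).div (hdd s hs) (hdpos s).ne').mul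
      (e1.const_mul σ)
    refine e2.congr_deriv ?_
    have hdn := (hdpos s).ne'
    have e3 : σ * (σ * s₂ s (X s) * fx s (X s) + fx s (X s) * b s (X s)) = fx s (X s) * d s := by
      simp only [hbdef, hd]
      linear_combination (fx s (X s) * (s₁ s (X s) + s₂ s (X s))) * hσ2
    have e4 : a s * fx s (X s) * J s = a s * J s / d s * (fx s (X s) * d s) := by
      field_simp
    rw [e4, ← e3]
    simp only [hR, Pi.mul_apply, Pi.div_apply]
    ring
  set g : ℝ → ℝ := fun s => exp 1 * M / (2 * c₀) *
    (3 * H s + (K * N + 2 * K * N * (V + c₁) / (2 * c₀)) * (1 / A s)) with hg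
  have hRb : ∀ s ∈ Ioo 0 t, |R s| ≤ g s := by
    intro s hs
    have hs' : s ∈ Icc 0 T := ⟨hs.1.le, hs.2.le.trans ht.2⟩
    have hdn := (hdpos s).ne'
    have e0 : R s = J s / d s * ((a' s + a s * bx s (X s) - a s * d' s / d s) * (σ * f s (X s))
        - a s * (a s / A s) * (σ * (f s (X s) + h s (X s)))) := by
      simp only [hR]; field_simp
    have e1 : |σ * f s (X s)| ≤ M := by rw [abs_mul, hσ, one_mul]; exact hfM _ _
    have e2 : |σ * (f s (X s) + h s (X s))| ≤ 2 * M := by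
      rw [abs_mul, hσ, one_mul, two_mul]
      exact (abs_add_le _ _).trans (add_le_add (hfM _ _) (hhM _ _))
    have e3 : |J s / d s| ≤ exp 1 / (2 * c₀) := by
      rw [abs_of_nonneg (div_nonneg (hJ0 s).le (hdpos s).le)]
      exact div_le_div₀ (exp_pos 1).le (hJe s ⟨hs.1.le, hs.2.le⟩) (by positivity) (hdl s)
    have e4 : |a s * bx s (X s)| ≤ K * N * (1 / A s) := by
      rw [abs_mul, abs_of_nonneg (D.nonneg s), hbxdef, abs_mul, hσ, one_mul, mul_one_div]
      exact (mul_le_of_le_one_left (abs_nonneg _) (D.le_one s)).trans (h₁.decayx s hs' _)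
    have e5 : |a s * d' s / d s| ≤ 2 * K * N * (V + c₁) / (2 * c₀) * (1 / A s) := by
      rw [abs_div, abs_mul, abs_of_nonneg (D.nonneg s), abs_of_pos (hdpos s), div_mul_eq_mul_div]
      refine div_le_div₀ (by have := hiApos s; positivity) ?_ (by positivity) (hdl s)
      exact (mul_le_of_le_one_left (abs_nonneg _) (D.le_one s)).trans (hd'b s hs)
    have e6 : |a s * (a s / A s)| ≤ H s := by
      rw [abs_of_nonneg (mul_nonneg (D.nonneg s) (div_nonneg (D.nonneg s) (D.pos s).le))]
      exact D.sq_le s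
    have e7 : |a' s + a s * bx s (X s) - a s * d' s / d s| ≤ H s + K * N * (1 / A s) +
        2 * K * N * (V + c₁) / (2 * c₀) * (1 / A s) :=
      (abs_sub _ _).trans (add_le_add ((abs_add_le _ _).trans (add_le_add (D.abs_le s) e4)) e5)
    have hH : 0 ≤ H s := (abs_nonneg _).trans e6
    rw [e0, abs_mul]
    calc _ ≤ exp 1 / (2 * c₀) * ((H s + K * N * (1 / A s) +
        2 * K * N * (V + c₁) / (2 * c₀) * (1 / A s)) * M + H s * (2 * M)) := by
          refine mul_le_mul e3 ?_ (abs_nonneg _) (by positivity)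
          refine (abs_sub _ _).trans (add_le_add ?_ ?_)
          · rw [abs_mul]
            exact mul_le_mul e7 e1 (abs_nonneg _) ((abs_nonneg _).trans e7)
          · rw [abs_mul]
            exact mul_le_mul e6 e2 (abs_nonneg _) hH
      _ = g s := by simp only [hg]; ring
  have haJ : Continuous fun s => a s * J s := D.conta.mul hJc
  have hYc : Continuous Y :=
    (haJ.div hdc fun s => (hdpos s).ne').mul (continuous_const.mul (cX hf.cont))
  have hRc : Continuous R := by
    refine Continuous.sub (Continuous.mul (Continuous.div ?_ (hdc.pow 2) fun s =>
      pow_ne_zero 2 (hdpos s).ne') (continuous_const.mul (cX hf.cont))) ?_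
    · exact (((D.conta'.mul hJc).add (D.conta.mul ((cX hb.contx).mul hJc))).mul hdc).sub
        (haJ.mul hd'c)
    · exact (haJ.div hdc fun s => (hdpos s).ne').mul (continuous_const.mul
        ((D.conta.div D.contA fun s => (D.pos s).ne').mul ((cX hf.cont).add (cX hh))))
  have hgc : Continuous g := continuous_const.mul
    ((continuous_const.mul D.contH).add (continuous_const.mul hiA))
  have hFc : Continuous fun s => a s * fx s (X s) * J s := (D.conta.mul (cX hf.contx)).mul hJc
  have hfin := abs_integral_le_of_hasDerivAt_add ht.1 hYc hFc hRc hgc hYd hRb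
  have hgI : ∫ s in (0 : ℝ)..t, g s ≤ exp 1 * M / (2 * c₀) * (3 * H₀ + (1 + 1 / (2 * c₀))) := by
    simp only [hg]
    have i1 : IntervalIntegrable (fun s => 3 * H s) volume 0 t :=
      (continuous_const.mul D.contH).intervalIntegrable _ _
    have i2 : IntervalIntegrable (fun s => (K * N + 2 * K * N * (V + c₁) / (2 * c₀)) * (1 / A s))
        volume 0 t := (continuous_const.mul hiA).intervalIntegrable _ _
    rw [intervalIntegral.integral_const_mul, intervalIntegral.integral_add i1 i2,
      intervalIntegral.integral_const_mul, intervalIntegral.integral_const_mul]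
    have e1 := D.int_le t ht.1
    have e2 := hsub 0 ⟨le_rfl, ht.1⟩
    have e3 : 0 ≤ ∫ s in (0 : ℝ)..t, 1 / A s :=
      intervalIntegral.integral_nonneg ht.1 fun s _ => (hiApos s).le
    have e4 : 2 * K * N * (V + c₁) * (∫ s in (0 : ℝ)..t, 1 / A s) ≤ 1 := by
      refine le_trans (mul_le_mul ?_ e2 e3 (by positivity)) h_int
      exact mul_le_mul_of_nonneg_left (by linarith) (by positivity)
    have e5 : K * N * (∫ s in (0 : ℝ)..t, 1 / A s) ≤ 1 := le_trans (by gcongr) hKNI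
    have e6 : 2 * K * N * (V + c₁) / (2 * c₀) * (∫ s in (0 : ℝ)..t, 1 / A s) ≤ 1 / (2 * c₀) := by
      rw [div_mul_eq_mul_div]; gcongr
    have e7 : (0 : ℝ) ≤ exp 1 * M / (2 * c₀) := by positivity
    refine mul_le_mul_of_nonneg_left ?_ e7
    rw [add_mul]
    linarith
  have hY1 := hYb t ⟨ht.1, le_rfl⟩
  have hY2 := hYb 0 ⟨le_rfl, ht.1⟩
  have hdata : |w₀' (flow b 0 t x) * jac b bx 0 t x| ≤ exp 1 * N₀ := by
    rw [abs_mul, mul_comm, abs_of_pos (jac_pos _ _ _ _ _)]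
    exact mul_le_mul (hJe 0 ⟨le_rfl, ht.1⟩) (hw₀ _) (abs_nonneg _) (exp_pos 1).le
  calc |trx b bx a fx w₀' t x| ≤ _ := abs_sub _ _
    _ ≤ exp 1 * N₀ + (exp 1 * M / (2 * c₀) + exp 1 * M / (2 * c₀) +
      exp 1 * M / (2 * c₀) * (3 * H₀ + (1 + 1 / (2 * c₀)))) := by
        refine add_le_add hdata (hfin.trans ?_)
        gcongr
    _ = _ := by ring

/-- Half the difference of the two Riemann invariants. -/
def hdiff (w : Bool → ℝ → ℝ → ℝ) (t x : ℝ) : ℝ := (w true t x - w false t x) / 2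

lemma hdiff_mem {w : Bool → ℝ → ℝ → ℝ} {M ρ : ℝ} (hw : ∀ i t x, |w i t x| ≤ M) (hM : M ≤ ρ)
    (t x : ℝ) : hdiff w t x ∈ Icc (-ρ) ρ := by
  have h1 := abs_le.1 (hw true t x)
  have h2 := abs_le.1 (hw false t x)
  constructor <;> simp only [hdiff] <;> linarith [h1.1, h1.2, h2.1, h2.2]

lemma abs_hdiff_le {w : Bool → ℝ → ℝ → ℝ} {M t x : ℝ} (hw : ∀ i, |w i t x| ≤ M) :
    |hdiff w t x| ≤ M := by
  have h1 := abs_le.1 (hw true)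
  have h2 := abs_le.1 (hw false)
  rw [abs_le]
  constructor <;> simp only [hdiff] <;> linarith [h1.1, h1.2, h2.1, h2.2]

/-- A positive wave speed on `[-ρ, ρ]` with bounded derivative. -/
structure Speed (c c' : ℝ → ℝ) (ρ c₀ c₁ K : ℝ) : Prop where
  hasDerivAt : ∀ k ∈ Icc (-ρ) ρ, HasDerivAt c (c' k) k
  contDeriv : ContinuousOn c' (Icc (-ρ) ρ)
  pos : 0 < c₀
  lower : ∀ k ∈ Icc (-ρ) ρ, c₀ ≤ c k
  upper : ∀ k ∈ Icc (-ρ) ρ, c k ≤ c₁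
  abs_deriv_le : ∀ k ∈ Icc (-ρ) ρ, |c' k| ≤ K

namespace Speed

variable {c c' : ℝ → ℝ} {ρ c₀ c₁ K : ℝ}

lemma continuousOn (S : Speed c c' ρ c₀ c₁ K) : ContinuousOn c (Icc (-ρ) ρ) :=
  fun k hk => (S.hasDerivAt k hk).continuousAt.continuousWithinAt

lemma abs_le (S : Speed c c' ρ c₀ c₁ K) {k : ℝ} (hk : k ∈ Icc (-ρ) ρ) : |c k| ≤ c₁ := by
  rw [abs_of_pos (S.pos.trans_le (S.lower k hk))]
  exact S.upper k hk

lemma abs_sub_le (S : Speed c c' ρ c₀ c₁ K) {k l : ℝ} (hk : k ∈ Icc (-ρ) ρ)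
    (hl : l ∈ Icc (-ρ) ρ) : |c k - c l| ≤ K * |k - l| := by
  simpa [Real.norm_eq_abs] using Convex.norm_image_sub_le_of_norm_hasDerivWithin_le
    (fun s hs => (S.hasDerivAt s hs).hasDerivWithinAt)
    (fun s hs => by simpa using S.abs_deriv_le s hs) (convex_Icc (-ρ) ρ) hl hk

lemma decaying (S : Speed c c' ρ c₀ c₁ K) {T M N V : ℝ} {A : ℝ → ℝ} {w wx wt : Bool → ℝ → ℝ → ℝ}
    (hw : ∀ i, Decaying T A M N V (w i) (wx i) (wt i)) (hM : M ≤ ρ) :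
    Decaying T A c₁ (K * N) V (fun t x => c (hdiff w t x))
      (fun t x => c' (hdiff w t x) * hdiff wx t x)
      (fun t x => c' (hdiff w t x) * hdiff wt t x) := by
  have hmem : ∀ t x, hdiff w t x ∈ Icc (-ρ) ρ := hdiff_mem (fun i => (hw i).bdd) hM
  have hK : 0 ≤ K := (abs_nonneg _).trans (S.abs_deriv_le _ (hmem 0 0))
  have hc : Continuous fun p : ℝ × ℝ => hdiff w p.1 p.2 :=
    ((hw true).cont.sub (hw false).cont).div_const 2
  have hc' : Continuous fun p : ℝ × ℝ => c' (hdiff w p.1 p.2) :=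
    S.contDeriv.comp_continuous hc fun p => hmem _ _
  have hmul : ∀ {t x B : ℝ} {y : Bool → ℝ → ℝ → ℝ}, (∀ i, |y i t x| ≤ B) →
      |c' (hdiff w t x) * hdiff y t x| ≤ K * B := by
    intro t x B y hy
    rw [abs_mul]
    exact mul_le_mul (S.abs_deriv_le _ (hmem _ _)) (abs_hdiff_le hy) (abs_nonneg _) hK
  refine ⟨⟨?_, ?_, ?_⟩, ?_, ?_, ?_, ?_, ?_, ?_⟩
  · exact S.continuousOn.comp_continuous hc fun p => hmem _ _
  · exact hc'.mul (((hw true).contx.sub (hw false).contx).div_const 2)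
  · intro t x
    exact (S.hasDerivAt _ (hmem t x)).comp x
      ((((hw true).hasDerivAt t x).sub ((hw false).hasDerivAt t x)).div_const 2)
  · exact hc'.mul (((hw true).contt.sub (hw false).contt).div_const 2)
  · intro t ht x
    exact HasDerivAt.comp t (S.hasDerivAt _ (hmem t x))
      ((((hw true).time t ht x).sub ((hw false).time t ht x)).div_const 2)
  · intro t x
    exact S.abs_le (hmem t x)
  · intro t x
    exact hmul fun i => (hw i).bddx t x
  · intro t ht x
    rw [mul_div_assoc]
    exact hmul fun i => (hw i).decayx t ht x
  · intro t ht x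
    refine (hmul fun i => (hw i).decayt t ht x).trans (le_of_eq ?_)
    ring

end Speed

/-- The data of a damped `2 × 2` diagonal hyperbolic problem with small initial data. -/
structure RiemannProblem where
  (A a a' H c c' : ℝ → ℝ)
  (w₀ w₀' : Bool → ℝ → ℝ)
  (H₀ ρ c₀ c₁ K M N N₀ T : ℝ)
  damping : Damping A a a' H H₀
  speed : Speed c c' ρ c₀ c₁ K
  M_le_ρ : M ≤ ρ
  M_le_N : M ≤ N
  hasDerivAt_w₀ : ∀ i x, HasDerivAt (w₀ i) (w₀' i x) x
  cont_w₀' : ∀ i, Continuous (w₀' i)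
  abs_w₀_le : ∀ i x, |w₀ i x| ≤ M
  abs_w₀'_le : ∀ i x, |w₀' i x| ≤ N₀
  le_N : exp 1 * (N₀ + M / (2 * c₀) * (3 + 3 * H₀ + 1 / (2 * c₀))) ≤ N
  T_nonneg : 0 ≤ T
  int_le : 2 * K * N * ((c₁ + 2) + c₁ + 1) * ∫ s in (0 : ℝ)..T, 1 / A s ≤ 1

/-- The sign of the characteristic speed of each of the two families. -/
def sig : Bool → ℝ
  | true => -1
  | false => 1

lemma abs_sig (i : Bool) : |sig i| = 1 := by cases i <;> simp [sig]

lemma sig_not (i : Bool) : sig (!i) = -sig i := by cases i <;> simp [sig]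

namespace RiemannProblem

variable (P : RiemannProblem)

/-- The field of characteristic directions of the family `i`. -/
def fld (i : Bool) (w : Bool → ℝ → ℝ → ℝ) (t x : ℝ) : ℝ := sig i * P.c (hdiff w t x)

/-- The spatial derivative of `fld`. -/
def fldx (i : Bool) (w wx : Bool → ℝ → ℝ → ℝ) (t x : ℝ) : ℝ :=
  sig i * (P.c' (hdiff w t x) * hdiff wx t x)

/-- The nearest time in `[0, T]`. -/
def clamp (t : ℝ) : ℝ := max 0 (min t P.T)

/-- The Picard iterates and their spatial derivatives. -/
def iter : ℕ → (Bool → ℝ → ℝ → ℝ) × (Bool → ℝ → ℝ → ℝ)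
  | 0 => (fun _ _ _ => 0, fun _ _ _ => 0)
  | n + 1 =>
    (fun i t x => tr (P.fld i (iter n).1) P.a ((iter n).1 (!i)) (P.w₀ i) (P.clamp t) x /
      P.A (P.clamp t),
    fun i t x => trx (P.fld i (iter n).1) (P.fldx i (iter n).1 (iter n).2) P.a ((iter n).2 (!i))
      (P.w₀' i) (P.clamp t) x / P.A (P.clamp t))

/-- The Picard iterates. -/
def w (n : ℕ) : Bool → ℝ → ℝ → ℝ := (P.iter n).1

/-- The spatial derivatives of the Picard iterates. -/
def wx (n : ℕ) : Bool → ℝ → ℝ → ℝ := (P.iter n).2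

/-- The time derivatives of the Picard iterates. -/
def wt (n : ℕ) (i : Bool) (t x : ℝ) : ℝ :=
  -(P.fld i (P.w (n - 1)) t x * P.wx n i t x) -
    P.a t / P.A t * (P.w n i t x + P.w (n - 1) (!i) t x)

lemma clamp_mem (t : ℝ) : P.clamp t ∈ Icc 0 P.T :=
  ⟨le_max_left _ _, max_le P.T_nonneg (min_le_right _ _)⟩

variable {P} in
lemma clamp_of_mem {t : ℝ} (ht : t ∈ Icc 0 P.T) : P.clamp t = t := by
  rw [clamp, min_eq_left ht.2, max_eq_right ht.1]

lemma continuous_clamp : Continuous P.clamp := by unfold clamp; fun_prop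

lemma integral_a {t : ℝ} (ht : 0 ≤ t) : ∫ s in (0 : ℝ)..t, P.a s = P.A t - 1 := by
  rw [intervalIntegral.integral_eq_sub_of_hasDerivAt_of_le ht P.damping.contA.continuousOn
    (fun s hs => P.damping.hasDerivAt_A s hs.1) (P.damping.conta.intervalIntegrable _ _),
    P.damping.A_zero]

lemma M_nonneg : 0 ≤ P.M := (abs_nonneg _).trans (P.abs_w₀_le true 0)

lemma N_nonneg : 0 ≤ P.N := P.M_nonneg.trans P.M_le_N

lemma zero_mem : (0 : ℝ) ∈ Icc (-P.ρ) P.ρ := by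
  have := P.M_nonneg.trans P.M_le_ρ
  constructor <;> linarith

lemma K_nonneg : 0 ≤ P.K := (abs_nonneg _).trans (P.speed.abs_deriv_le 0 P.zero_mem)

lemma c₁_nonneg : 0 ≤ P.c₁ := (abs_nonneg _).trans (P.speed.abs_le P.zero_mem)

lemma abs_fld_le {v : Bool → ℝ → ℝ → ℝ} (hv : ∀ i t x, |v i t x| ≤ P.M) (i : Bool) (t x : ℝ) :
    |P.fld i v t x| ≤ P.c₁ := by
  rw [fld, abs_mul, abs_sig, one_mul]
  exact P.speed.abs_le (hdiff_mem hv P.M_le_ρ t x)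

lemma w_succ (n : ℕ) (i : Bool) (t x : ℝ) : P.w (n + 1) i t x =
    tr (P.fld i (P.w n)) P.a (P.w n (!i)) (P.w₀ i) (P.clamp t) x / P.A (P.clamp t) := rfl

lemma wx_succ (n : ℕ) (i : Bool) (t x : ℝ) : P.wx (n + 1) i t x =
    trx (P.fld i (P.w n)) (P.fldx i (P.w n) (P.wx n)) P.a (P.wx n (!i)) (P.w₀' i) (P.clamp t) x /
      P.A (P.clamp t) := rfl

lemma abs_tr_le {b f : ℝ → ℝ → ℝ} (hf : ∀ t x, |f t x| ≤ P.M) (i : Bool) {t : ℝ} (ht : 0 ≤ t)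
    (x : ℝ) : |tr b P.a f (P.w₀ i) t x| ≤ P.M * P.A t := by
  have h1 : ‖∫ s in (0 : ℝ)..t, P.a s * f s (flow b s t x)‖ ≤ ∫ s in (0 : ℝ)..t, P.a s * P.M := by
    refine intervalIntegral.norm_integral_le_of_norm_le ht (Eventually.of_forall fun s _ => ?_)
      ((P.damping.conta.mul continuous_const).intervalIntegrable _ _)
    rw [Real.norm_eq_abs, abs_mul, abs_of_nonneg (P.damping.nonneg s)]
    exact mul_le_mul_of_nonneg_left (hf _ _) (P.damping.nonneg s)
  rw [intervalIntegral.integral_mul_const, P.integral_a ht, Real.norm_eq_abs] at h1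
  refine (abs_sub _ _).trans ((add_le_add (P.abs_w₀_le i _) h1).trans (le_of_eq ?_))
  ring

lemma decaying_step {n : ℕ}
    (h : ∀ i, Decaying P.T P.A P.M P.N (P.c₁ + 2) (P.w n i) (P.wx n i) (P.wt n i))
    (h' : ∀ i, Decaying P.T P.A P.M P.N (P.c₁ + 2) (P.w (n - 1) i) (P.wx (n - 1) i)
      (P.wt (n - 1) i)) (i : Bool) :
    Decaying P.T P.A P.M P.N (P.c₁ + 2) (P.w (n + 1) i) (P.wx (n + 1) i) (P.wt (n + 1) i) := by
  have D := P.damping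
  have hs := P.speed.decaying h P.M_le_ρ
  have hb : C1Field (P.fld i (P.w n)) (P.fldx i (P.w n) (P.wx n)) (P.K * P.N) P.c₁ :=
    hs.c1Field (abs_sig i)
  have hC := hb.spaceC1_tr D.conta (h (!i)).toSpaceC1 (P.hasDerivAt_w₀ i) (P.cont_w₀' i)
  have hcl : Continuous fun p : ℝ × ℝ => P.clamp p.1 := P.continuous_clamp.comp continuous_fst
  have hA : Continuous fun p : ℝ × ℝ => P.A (P.clamp p.1) := D.contA.comp hcl
  have hw : Continuous fun p : ℝ × ℝ => P.w (n + 1) i p.1 p.2 :=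
    (hC.cont.comp₂ hcl continuous_snd).div hA fun p => (D.pos _).ne'
  have hwx : Continuous fun p : ℝ × ℝ => P.wx (n + 1) i p.1 p.2 :=
    (hC.contx.comp₂ hcl continuous_snd).div hA fun p => (D.pos _).ne'
  have hbdd : ∀ t x, |P.w (n + 1) i t x| ≤ P.M := by
    intro t x
    rw [w_succ, abs_div, abs_of_pos (D.pos _), div_le_iff₀ (D.pos _)]
    exact P.abs_tr_le (h (!i)).bdd i (P.clamp_mem t).1 x
  have hdecx : ∀ t x, |P.wx (n + 1) i t x| ≤ P.N / P.A (P.clamp t) := by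
    intro t x
    rw [wx_succ, abs_div, abs_of_pos (D.pos _)]
    refine div_le_div_of_nonneg_right (le_trans ?_ P.le_N) (D.pos _).le
    refine abs_trx_le D hs (P.speed.decaying h' P.M_le_ρ) P.speed.pos
      (fun t x => P.speed.lower _ (hdiff_mem (fun i => (h i).bdd) P.M_le_ρ t x))
      (fun t x => P.speed.lower _ (hdiff_mem (fun i => (h' i).bdd) P.M_le_ρ t x))
      (h (!i)).toSpaceC1 (h' i).cont ?_ (h (!i)).bdd (h' i).bdd (P.abs_w₀'_le i) (abs_sig i)
      P.K_nonneg P.N_nonneg (by linarith [P.c₁_nonneg]) P.int_le (P.clamp_mem t) x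
    intro s hs x
    refine ((h (!i)).time s hs x).congr_deriv ?_
    rw [wt, fld, sig_not, Bool.not_not]
    ring
  refine ⟨⟨hw, hwx, ?_⟩, ?_, ?_, hbdd, ?_, ?_, ?_⟩
  · intro t x
    exact (hC.hasDerivAt (P.clamp t) x).div_const _
  · refine ((hb.cont.mul hwx).neg.sub (Continuous.mul ?_ (hw.add (h (!i)).cont)))
    exact (D.conta.comp continuous_fst).div (D.contA.comp continuous_fst) fun p => (D.pos _).ne'
  · intro t ht x
    have e1 := (hb.hasDerivAt_tr_time D.conta (h (!i)).toSpaceC1 (P.hasDerivAt_w₀ i)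
      (P.cont_w₀' i) t x).div (D.hasDerivAt_A t ht.1) (D.pos t).ne'
    have e2 : (fun t => P.w (n + 1) i t x) =ᶠ[𝓝 t]
        (fun t => tr (P.fld i (P.w n)) P.a (P.w n (!i)) (P.w₀ i) t x) / P.A := by
      filter_upwards [isOpen_Ioo.mem_nhds ht] with s hs
      rw [w_succ, clamp_of_mem (Ioo_subset_Icc_self hs), Pi.div_apply]
    refine (e1.congr_of_eventuallyEq e2).congr_deriv ?_
    have hA := (D.pos t).ne'
    rw [wt, w_succ, wx_succ, clamp_of_mem (Ioo_subset_Icc_self ht), Nat.add_sub_cancel]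
    field_simp
    ring
  · intro t x
    refine (hdecx t x).trans (div_le_self P.N_nonneg (D.one_le _))
  · intro t ht x
    simpa only [clamp_of_mem ht] using hdecx t x
  · intro t ht x
    have e1 := hdecx t x
    rw [clamp_of_mem (Ioo_subset_Icc_self ht)] at e1
    have e2 := P.abs_fld_le (fun i => (h i).bdd) i t x
    have e3 : |P.a t / P.A t| ≤ 1 / P.A t := by
      rw [abs_div, abs_of_pos (D.pos t), abs_of_nonneg (D.nonneg t)]
      exact div_le_div_of_nonneg_right (D.le_one t) (D.pos t).le
    have e4 : |P.w (n + 1) i t x + P.w n (!i) t x| ≤ 2 * P.N := by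
      refine (abs_add_le _ _).trans ?_
      linarith [hbdd t x, (h (!i)).bdd t x, P.M_le_N]
    rw [wt, Nat.add_sub_cancel]
    calc _ ≤ |P.fld i (P.w n) t x * P.wx (n + 1) i t x| +
          |P.a t / P.A t * (P.w (n + 1) i t x + P.w n (!i) t x)| := by
          rw [← abs_neg (P.fld i (P.w n) t x * P.wx (n + 1) i t x)]
          exact abs_sub _ _
      _ ≤ P.c₁ * (P.N / P.A t) + 1 / P.A t * (2 * P.N) := by
          rw [abs_mul, abs_mul]
          exact add_le_add (mul_le_mul e2 e1 (abs_nonneg _) P.c₁_nonneg)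
            (mul_le_mul e3 e4 (abs_nonneg _) (one_div_pos.2 (D.pos t)).le)
      _ = _ := by ring

/-- The Picard iterates satisfy uniform bounds. -/
lemma decaying (n : ℕ) (i : Bool) :
    Decaying P.T P.A P.M P.N (P.c₁ + 2) (P.w n i) (P.wx n i) (P.wt n i) := by
  have h0 : ∀ i, Decaying P.T P.A P.M P.N (P.c₁ + 2) (P.w 0 i) (P.wx 0 i) (P.wt 0 i) := by
    intro i
    have e : P.wt 0 i = fun _ _ => 0 := by
      funext t x
      simp [wt, w, wx, iter]
    have hA := fun t => (P.damping.pos t).le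
    have hN := P.N_nonneg
    have hc := P.c₁_nonneg
    rw [e]
    refine ⟨⟨continuous_const, continuous_const, fun t x => hasDerivAt_const x 0⟩,
      continuous_const, fun t _ x => hasDerivAt_const t 0, ?_, ?_, ?_, ?_⟩
    · intro t x
      simpa [w, iter] using P.M_nonneg
    · intro t x
      simpa [wx, iter] using hN
    · intro t _ x
      simpa [wx, iter] using div_nonneg hN (hA t)
    · intro t _ x
      rw [abs_zero]
      exact div_nonneg (by positivity) (hA t)
  suffices h : ∀ n, (∀ i, Decaying P.T P.A P.M P.N (P.c₁ + 2) (P.w n i) (P.wx n i) (P.wt n i)) ∧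
      ∀ i, Decaying P.T P.A P.M P.N (P.c₁ + 2) (P.w (n - 1) i) (P.wx (n - 1) i)
        (P.wt (n - 1) i) from (h n).1 i
  intro n
  induction n with
  | zero => exact ⟨h0, h0⟩
  | succ n ih => exact ⟨P.decaying_step ih.1 ih.2, ih.1⟩

end RiemannProblem

lemma abs_le_of_abs_hasDerivAt_le {f f' B B' : ℝ → ℝ} {t : ℝ} (ht : 0 ≤ t)
    (hf : ContinuousOn f (Icc 0 t)) (hB : ContinuousOn B (Icc 0 t))
    (hf' : ∀ s ∈ Ioo 0 t, HasDerivAt f (f' s) s) (hB' : ∀ s ∈ Ioo 0 t, HasDerivAt B (B' s) s)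
    (hle : ∀ s ∈ Ioo 0 t, |f' s| ≤ B' s) (h0 : |f 0| ≤ B 0) : |f t| ≤ B t := by
  have h1 : MonotoneOn (fun s => B s - f s) (Icc 0 t) :=
    monotoneOn_of_hasDerivWithinAt_nonneg (convex_Icc _ _) (hB.sub hf)
      (f' := fun s => B' s - f' s)
      (fun s hs => by
        rw [interior_Icc] at hs ⊢
        exact ((hB' s hs).sub (hf' s hs)).hasDerivWithinAt)
      (fun s hs => by
        rw [interior_Icc] at hs
        linarith [(abs_le.1 (hle s hs)).2])
  have h2 : MonotoneOn (fun s => B s + f s) (Icc 0 t) :=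
    monotoneOn_of_hasDerivWithinAt_nonneg (convex_Icc _ _) (hB.add hf)
      (f' := fun s => B' s + f' s)
      (fun s hs => by
        rw [interior_Icc] at hs ⊢
        exact ((hB' s hs).add (hf' s hs)).hasDerivWithinAt)
      (fun s hs => by
        rw [interior_Icc] at hs
        linarith [(abs_le.1 (hle s hs)).1])
  have m0 : (0 : ℝ) ∈ Icc 0 t := ⟨le_rfl, ht⟩
  have mt : t ∈ Icc 0 t := ⟨ht, le_rfl⟩
  have h3 := h1 m0 mt ht
  have h4 := h2 m0 mt ht
  simp only at h3 h4
  rw [abs_le] at h0 ⊢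
  constructor <;> linarith [h0.1, h0.2]

lemma hasDerivAt_pow_div_factorial (C G : ℝ) (n : ℕ) (s : ℝ) :
    HasDerivAt (fun s => C * (G * s) ^ (n + 1) / (n + 1).factorial)
      (G * (C * (G * s) ^ n / n.factorial)) s := by
  have h := ((((hasDerivAt_id s).const_mul G).pow (n + 1)).const_mul C).div_const
    ((n + 1).factorial : ℝ)
  refine h.congr_deriv ?_
  have h1 : (n.factorial : ℝ) ≠ 0 := by positivity
  rw [Nat.factorial_succ]
  push_cast
  simp only [id]
  field_simp

namespace RiemannProblem

variable (P : RiemannProblem)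

lemma w_mem (n : ℕ) (t x : ℝ) : hdiff (P.w n) t x ∈ Icc (-P.ρ) P.ρ :=
  hdiff_mem (fun i => (P.decaying n i).bdd) P.M_le_ρ t x

lemma c1Field (n : ℕ) (i : Bool) :
    C1Field (P.fld i (P.w n)) (P.fldx i (P.w n) (P.wx n)) (P.K * P.N) P.c₁ :=
  (P.speed.decaying (P.decaying n) P.M_le_ρ).c1Field (abs_sig i)

lemma w_zero_time (n : ℕ) (i : Bool) (x : ℝ) : P.w (n + 1) i 0 x = P.w₀ i x := by
  rw [w_succ, clamp_of_mem ⟨le_rfl, P.T_nonneg⟩, (P.c1Field n i).tr_zero, P.damping.A_zero, div_one]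

lemma w_clamp (n : ℕ) (i : Bool) (t x : ℝ) : P.w n i (P.clamp t) x = P.w n i t x := by
  cases n with
  | zero => rfl
  | succ n => rw [w_succ, w_succ, clamp_of_mem (P.clamp_mem t)]

lemma abs_fld_sub_le {u v : Bool → ℝ → ℝ → ℝ} {t x e : ℝ} (hu : hdiff u t x ∈ Icc (-P.ρ) P.ρ)
    (hv : hdiff v t x ∈ Icc (-P.ρ) P.ρ) (h : ∀ i, |u i t x - v i t x| ≤ e) (i : Bool) :
    |P.fld i u t x - P.fld i v t x| ≤ P.K * e := by
  rw [fld, fld, ← mul_sub, abs_mul, abs_sig, one_mul]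
  refine (P.speed.abs_sub_le hu hv).trans (mul_le_mul_of_nonneg_left ?_ P.K_nonneg)
  have := abs_hdiff_le (w := fun i t x => u i t x - v i t x) h
  refine le_trans (le_of_eq ?_) this
  simp only [hdiff]
  congr 1
  ring

lemma abs_w_sub_le (n : ℕ) : ∀ i, ∀ t ∈ Icc 0 P.T, ∀ x,
    |P.w (n + 2) i t x - P.w (n + 1) i t x| ≤
      2 * P.M * ((1 + P.K * P.N) * t) ^ n / n.factorial := by
  induction n with
  | zero =>
    intro i t _ x
    simp only [pow_zero, mul_one, Nat.factorial_zero, Nat.cast_one, div_one]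
    refine (abs_sub _ _).trans ?_
    linarith [(P.decaying (0 + 2) i).bdd t x, (P.decaying (0 + 1) i).bdd t x]
  | succ n ih =>
    intro i t ht x
    have D := P.damping
    have hb := P.c1Field (n + 2) i
    set b := P.fld i (P.w (n + 2)) with hbdef
    set X : ℝ → ℝ := fun s => flow b s t x with hX
    have hXd : ∀ s, HasDerivAt X (b s (X s)) s := fun s => hb.lipField.hasDerivAt_flow s t x
    have hXc : Continuous X :=
      hb.lipField.continuous_flow continuous_id continuous_const continuous_const
    have h3 := P.decaying (n + 3) i
    have h2 := P.decaying (n + 2) i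
    have hmain : |P.A t * (P.w (n + 3) i t (X t) - P.w (n + 2) i t (X t))| ≤
        2 * P.M * ((1 + P.K * P.N) * t) ^ (n + 1) / (n + 1).factorial := by
      refine abs_le_of_abs_hasDerivAt_le ht.1
        (f := fun s => P.A s * (P.w (n + 3) i s (X s) - P.w (n + 2) i s (X s)))
        (f' := fun s => P.a s * (P.w (n + 1) (!i) s (X s) - P.w (n + 2) (!i) s (X s)) -
          (b s (X s) - P.fld i (P.w (n + 1)) s (X s)) * (P.A s * P.wx (n + 2) i s (X s)))
        (B := fun s => 2 * P.M * ((1 + P.K * P.N) * s) ^ (n + 1) / (n + 1).factorial)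
        ?_ ?_ ?_ (fun s _ => hasDerivAt_pow_div_factorial _ _ n s) ?_ ?_
      · exact (D.contA.mul ((h3.cont.comp₂ continuous_id hXc).sub
          (h2.cont.comp₂ continuous_id hXc))).continuousOn
      · fun_prop
      · intro s hs
        have hs' : s ∈ Ioo 0 P.T := ⟨hs.1, hs.2.trans_le ht.2⟩
        have e := (D.hasDerivAt_A s hs.1).mul ((h3.hasDerivAt_along (hXd s) (h3.time s hs' _)).sub
          (h2.hasDerivAt_along (hXd s) (h2.time s hs' _)))
        refine e.congr_deriv ?_
        have hA := (D.pos s).ne'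
        simp only [wt, Pi.sub_apply, hbdef,
          show n + 3 - 1 = n + 2 from rfl, show n + 2 - 1 = n + 1 from rfl]
        field_simp
        ring
      · intro s hs
        have hs' : s ∈ Icc 0 P.T := ⟨hs.1.le, hs.2.le.trans ht.2⟩
        set e := 2 * P.M * ((1 + P.K * P.N) * s) ^ n / n.factorial
        have e1 : |P.a s * (P.w (n + 1) (!i) s (X s) - P.w (n + 2) (!i) s (X s))| ≤ e := by
          rw [abs_mul, abs_of_nonneg (D.nonneg s), abs_sub_comm]
          exact (mul_le_of_le_one_left (abs_nonneg _) (D.le_one s)).trans (ih _ s hs' _)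
        have e2 : |b s (X s) - P.fld i (P.w (n + 1)) s (X s)| ≤ P.K * e :=
          P.abs_fld_sub_le (P.w_mem _ _ _) (P.w_mem _ _ _) (fun j => ih j s hs' _) i
        have e3 : |P.A s * P.wx (n + 2) i s (X s)| ≤ P.N := by
          rw [abs_mul, abs_of_pos (D.pos s), mul_comm]
          exact (le_div_iff₀ (D.pos s)).1 (h2.decayx s hs' _)
        calc _ ≤ e + P.K * e * P.N := by
              refine (abs_sub _ _).trans (add_le_add e1 ?_)
              rw [abs_mul]
              exact mul_le_mul e2 e3 (abs_nonneg _) ((abs_nonneg _).trans e2)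
          _ = _ := by ring
      · rw [w_zero_time, w_zero_time]
        simp
    have hXt : X t = x := hb.lipField.flow_self t x
    rw [hXt, abs_mul, abs_of_pos (D.pos t)] at hmain
    exact (le_mul_of_one_le_left (abs_nonneg _) (D.one_le t)).trans hmain

/-- The Picard iterates converge uniformly. -/
lemma exists_limit : ∃ (u : Bool → ℝ → ℝ → ℝ) (η : ℕ → ℝ), Tendsto η atTop (𝓝 0) ∧
    ∀ n i t x, |P.w n i t x - u i t x| ≤ η n := by
  set G := 1 + P.K * P.N with hG
  have hG0 : 0 ≤ G := by have := P.K_nonneg; have := P.N_nonneg; positivity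
  set d : ℕ → ℝ := fun n => 2 * P.M * ((G * P.T) ^ n / n.factorial) with hd
  have hsum : Summable d := (Real.summable_pow_div_factorial _).mul_left _
  have hd1 : ∀ i t x n, dist (P.w (n + 1) i t x) (P.w (n + 1 + 1) i t x) ≤ d n := by
    intro i t x n
    rw [dist_comm, Real.dist_eq, ← P.w_clamp (n + 1), ← P.w_clamp (n + 1 + 1)]
    refine (P.abs_w_sub_le n i _ (P.clamp_mem t) x).trans ?_
    rw [mul_div_assoc]
    have h0 := (P.clamp_mem t).1
    have h1 := (P.clamp_mem t).2
    have := P.M_nonneg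
    simp only [hd]
    gcongr
  have hlim : ∀ i t x, ∃ l, Tendsto (fun n => P.w (n + 1) i t x) atTop (𝓝 l) := fun i t x =>
    cauchySeq_tendsto_of_complete (cauchySeq_of_dist_le_of_summable d (hd1 i t x) hsum)
  choose u hu using hlim
  refine ⟨u, fun n => if n = 0 then P.M + P.M else ∑' m, d (m + (n - 1)), ?_, ?_⟩
  · rw [← tendsto_add_atTop_iff_nat 1]
    simpa using tendsto_sum_nat_add d
  · intro n i t x
    cases n with
    | zero =>
      have h1 : |u i t x| ≤ P.M :=
        le_of_tendsto (hu i t x).abs (Eventually.of_forall fun n => (P.decaying _ i).bdd t x)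
      simpa using (abs_sub _ _).trans (add_le_add ((P.decaying 0 i).bdd t x) h1)
    | succ n =>
      have h1 := dist_le_tsum_of_dist_le_of_tendsto d (hd1 i t x) hsum (hu i t x) n
      rw [Real.dist_eq] at h1
      simpa [add_comm] using h1

end RiemannProblem

namespace RiemannProblem

variable (P : RiemannProblem)

/-- `u` is the uniform limit, with rate `η`, of the Picard iterates. -/
structure IsLimit (u : Bool → ℝ → ℝ → ℝ) (η : ℕ → ℝ) : Prop where
  tendsto : Tendsto η atTop (𝓝 0)
  abs_sub_le : ∀ n i t x, |P.w n i t x - u i t x| ≤ η n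

/-- The weighted spatial derivatives of the Picard iterates. -/
def y (n : ℕ) (i : Bool) (t x : ℝ) : ℝ := P.A (P.clamp t) * P.wx n i t x

/-- The source of the weighted derivative along the characteristic through `(t, x)`. -/
def src (i : Bool) (q : ℕ × ℝ × ℝ) (s : ℝ) : ℝ :=
  P.fldx i (P.w q.1) (P.wx q.1) s (flow (P.fld i (P.w q.1)) s (P.clamp q.2.1) q.2.2) *
    P.y (q.1 + 1) i s (flow (P.fld i (P.w q.1)) s (P.clamp q.2.1) q.2.2) +
  P.a s * P.wx q.1 (!i) s (flow (P.fld i (P.w q.1)) s (P.clamp q.2.1) q.2.2)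

variable {P}

namespace IsLimit

variable {u : Bool → ℝ → ℝ → ℝ} {η : ℕ → ℝ}

lemma tendsto_w (h : P.IsLimit u η) (i : Bool) (t x : ℝ) :
    Tendsto (fun n => P.w n i t x) atTop (𝓝 (u i t x)) :=
  tendsto_iff_dist_tendsto_zero.2 (squeeze_zero (fun _ => dist_nonneg)
    (fun n => h.abs_sub_le n i t x) h.tendsto)

lemma continuous (h : P.IsLimit u η) (i : Bool) : Continuous fun p : ℝ × ℝ => u i p.1 p.2 := by
  have h1 : TendstoUniformly (fun n (p : ℝ × ℝ) => P.w n i p.1 p.2) (fun p => u i p.1 p.2)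
      atTop := by
    rw [Metric.tendstoUniformly_iff]
    intro ε hε
    filter_upwards [h.tendsto.eventually (gt_mem_nhds hε)] with n hn p
    rw [dist_comm]
    exact (h.abs_sub_le n i p.1 p.2).trans_lt hn
  exact h1.continuous (Eventually.of_forall fun n => (P.decaying n i).cont).frequently

lemma abs_le (h : P.IsLimit u η) (i : Bool) (t x : ℝ) : |u i t x| ≤ P.M :=
  le_of_tendsto (h.tendsto_w i t x).abs (Eventually.of_forall fun n => (P.decaying n i).bdd t x)

lemma mem (h : P.IsLimit u η) (t x : ℝ) : hdiff u t x ∈ Icc (-P.ρ) P.ρ :=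
  hdiff_mem h.abs_le P.M_le_ρ t x

lemma abs_fld_sub_le (h : P.IsLimit u η) (i : Bool) (n : ℕ) (t x : ℝ) :
    |P.fld i (P.w n) t x - P.fld i u t x| ≤ P.K * η n :=
  P.abs_fld_sub_le (P.w_mem n t x) (h.mem t x) (fun j => h.abs_sub_le n j t x) i

lemma tendsto_K_mul (h : P.IsLimit u η) : Tendsto (fun n => P.K * η n) atTop (𝓝 0) := by
  simpa using h.tendsto.const_mul P.K

lemma continuous_hdiff (h : P.IsLimit u η) : Continuous fun p : ℝ × ℝ => hdiff u p.1 p.2 :=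
  ((h.continuous true).sub (h.continuous false)).div_const 2

lemma lipField (h : P.IsLimit u η) (i : Bool) : LipField (P.fld i u) (P.K * P.N) P.c₁ where
  cont := continuous_const.mul (P.speed.continuousOn.comp_continuous h.continuous_hdiff
    fun p => h.mem p.1 p.2)
  bdd := P.abs_fld_le h.abs_le i
  lip t x y := by
    have hl : ∀ x, Tendsto (fun n => P.fld i (P.w n) t x) atTop (𝓝 (P.fld i u t x)) := fun x =>
      tendsto_iff_dist_tendsto_zero.2 (squeeze_zero (fun _ => dist_nonneg)
        (fun n => h.abs_fld_sub_le i n t x) h.tendsto_K_mul)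
    exact le_of_tendsto ((hl x).sub (hl y)).abs
      (Eventually.of_forall fun n => (P.c1Field n i).lipField.lip t x y)

lemma tendsto_char (h : P.IsLimit u η) (i : Bool) {t : ℝ} (ht : t ∈ Icc 0 P.T) (s x : ℝ) :
    Tendsto (fun q : ℕ × ℝ × ℝ => flow (P.fld i (P.w q.1)) s (P.clamp q.2.1) q.2.2)
      (atTop ×ˢ 𝓝 (t, x)) (𝓝 (flow (P.fld i u) s t x)) := by
  refine (h.lipField i).tendsto_flow (b' := fun q : ℕ × ℝ × ℝ => P.fld i (P.w q.1))
    (fun q => (P.c1Field q.1 i).lipField)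
    (fun q => h.abs_fld_sub_le i q.1) (h.tendsto_K_mul.comp tendsto_fst) tendsto_const_nhds ?_ ?_
  · have := (P.continuous_clamp.comp (continuous_fst (X := ℝ) (Y := ℝ))).tendsto (t, x)
    simp only [Function.comp_apply, clamp_of_mem ht] at this
    exact this.comp tendsto_snd
  · exact (continuous_snd.tendsto (t, x)).comp tendsto_snd

lemma tendsto_deriv_speed (h : P.IsLimit u η) {ι : Type*} {l : Filter ι} {n : ι → ℕ} {X : ι → ℝ}
    {s x : ℝ} (hn : Tendsto n l atTop) (hX : Tendsto X l (𝓝 x)) :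
    Tendsto (fun q => P.c' (hdiff (P.w (n q)) s (X q))) l (𝓝 (P.c' (hdiff u s x))) := by
  have h1 : ∀ i, Tendsto (fun q => P.w (n q) i s (X q)) l (𝓝 (u i s x)) := by
    intro i
    have h2 : Tendsto (fun q => u i s (X q)) l (𝓝 (u i s x)) :=
      (((h.continuous i).comp (continuous_const.prodMk continuous_id)).tendsto x).comp hX
    have h3 : Tendsto (fun q => P.w (n q) i s (X q) - u i s (X q)) l (𝓝 0) :=
      squeeze_zero_norm (fun q => h.abs_sub_le (n q) i s (X q)) (h.tendsto.comp hn)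
    simpa using h3.add h2
  exact (P.speed.contDeriv _ (h.mem s x)).tendsto.comp
    (tendsto_nhdsWithin_iff.2 ⟨((h1 true).sub (h1 false)).div_const 2,
      Eventually.of_forall fun q => P.w_mem _ _ _⟩)

end IsLimit

variable (P)

lemma abs_y_le (n : ℕ) (i : Bool) {t : ℝ} (ht : t ∈ Icc 0 P.T) (x : ℝ) : |P.y n i t x| ≤ P.N := by
  rw [y, clamp_of_mem ht, abs_mul, abs_of_pos (P.damping.pos t), mul_comm]
  exact (le_div_iff₀ (P.damping.pos t)).1 ((P.decaying n i).decayx t ht x)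

lemma y_clamp (n : ℕ) (i : Bool) (t x : ℝ) : P.y n i (P.clamp t) x = P.y n i t x := by
  cases n with
  | zero => simp [y, wx, iter]
  | succ n => simp only [y, wx_succ, clamp_of_mem (P.clamp_mem t)]

lemma continuous_y (n : ℕ) (i : Bool) : Continuous fun p : ℝ × ℝ => P.y n i p.1 p.2 :=
  (P.damping.contA.comp (P.continuous_clamp.comp continuous_fst)).mul (P.decaying n i).contx

lemma y_succ (n : ℕ) (i : Bool) (t x : ℝ) : P.y (n + 1) i t x =
    trx (P.fld i (P.w n)) (P.fldx i (P.w n) (P.wx n)) P.a (P.wx n (!i)) (P.w₀' i) (P.clamp t) x :=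
  mul_div_cancel₀ _ (P.damping.pos _).ne'

lemma y_succ_eq (n : ℕ) (i : Bool) (t x : ℝ) : P.y (n + 1) i t x =
    P.w₀' i (flow (P.fld i (P.w n)) 0 (P.clamp t) x) -
      ∫ s in (0 : ℝ)..P.clamp t, P.src i (n, t, x) s := by
  rw [y_succ, (P.c1Field n i).trx_eq P.damping.conta (P.decaying n (!i)).toSpaceC1
    (P.hasDerivAt_w₀ i) (P.cont_w₀' i)]
  congr 1
  refine intervalIntegral.integral_congr fun s hs => ?_
  rw [uIcc_of_le (P.clamp_mem t).1] at hs
  have hs' : s ∈ Icc 0 P.T := ⟨hs.1, hs.2.trans (P.clamp_mem t).2⟩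
  simp only [src, y_succ, clamp_of_mem hs']

lemma continuous_src (i : Bool) (q : ℕ × ℝ × ℝ) : Continuous (P.src i q) := by
  have hX : Continuous fun s => flow (P.fld i (P.w q.1)) s (P.clamp q.2.1) q.2.2 :=
    (P.c1Field q.1 i).lipField.continuous_flow continuous_id continuous_const continuous_const
  exact (((P.c1Field q.1 i).contx.comp₂ continuous_id hX).mul
    ((P.continuous_y _ i).comp₂ continuous_id hX)).add
      (P.damping.conta.mul ((P.decaying q.1 (!i)).contx.comp₂ continuous_id hX))

lemma abs_src_le (i : Bool) (q : ℕ × ℝ × ℝ) {s : ℝ} (hs : s ∈ Icc 0 P.T) :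
    |P.src i q s| ≤ P.K * P.N * P.N + P.N := by
  refine (abs_add_le _ _).trans (add_le_add ?_ ?_)
  · rw [abs_mul]
    exact mul_le_mul ((P.c1Field q.1 i).bddx _ _) (P.abs_y_le _ _ hs _) (abs_nonneg _)
      (mul_nonneg P.K_nonneg P.N_nonneg)
  · rw [abs_mul, abs_of_nonneg (P.damping.nonneg s)]
    exact (mul_le_of_le_one_left (abs_nonneg _) (P.damping.le_one s)).trans
      ((P.decaying _ _).bddx _ _)

lemma abs_wx_sub_le (n m : ℕ) (i : Bool) {s : ℝ} (x z : ℝ) :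
    |P.wx n i s x - P.wx m i s z| ≤ |P.y n i s x - P.y m i s z| := by
  rw [y, y, ← mul_sub, abs_mul, abs_of_pos (P.damping.pos _)]
  exact le_mul_of_one_le_left (abs_nonneg _) (P.damping.one_le _)

/-- The oscillation of the weighted derivatives at points of `[0, T] × ℝ` is asymptotically at
most `e`. -/
def OscLE (e : ℝ → ℝ) : Prop := ∀ i, ∀ t ∈ Icc 0 P.T, ∀ x,
  ∃ r : (ℕ × ℝ × ℝ) × (ℕ × ℝ × ℝ) → ℝ,
    Tendsto r ((atTop ×ˢ 𝓝 (t, x)) ×ˢ (atTop ×ˢ 𝓝 (t, x))) (𝓝 0) ∧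
    ∀ q, |P.y q.1.1 i q.1.2.1 q.1.2.2 - P.y q.2.1 i q.2.2.1 q.2.2.2| ≤ e t + r q

variable {P}

lemma OscLE.src {e : ℝ → ℝ} (he : P.OscLE e) {u : Bool → ℝ → ℝ → ℝ} {η : ℕ → ℝ}
    (h : P.IsLimit u η) (i : Bool) {t s : ℝ} (ht : t ∈ Icc 0 P.T) (hs : s ∈ Icc 0 P.T) (x : ℝ) :
    ∃ r : (ℕ × ℝ × ℝ) × (ℕ × ℝ × ℝ) → ℝ,
      Tendsto r ((atTop ×ˢ 𝓝 (t, x)) ×ˢ (atTop ×ˢ 𝓝 (t, x))) (𝓝 0) ∧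
      ∀ q, |P.src i q.1 s - P.src i q.2 s| ≤ (2 * P.K * P.N + 1) * e s + r q := by
  set X : ℕ × ℝ × ℝ → ℝ := fun q => flow (P.fld i (P.w q.1)) s (P.clamp q.2.1) q.2.2 with hX
  set L : Filter (ℕ × ℝ × ℝ) := atTop ×ˢ 𝓝 (t, x) with hL
  have hXt : Tendsto X L (𝓝 (flow (P.fld i u) s t x)) := h.tendsto_char i ht s x
  have hpt : Tendsto (fun q => (s, X q)) L (𝓝 (s, flow (P.fld i u) s t x)) :=
    tendsto_const_nhds.prodMk_nhds hXt
  have hq : ∀ k : ℕ, Tendsto (fun q : ℕ × ℝ × ℝ => (q.1 + k, s, X q)) L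
      (atTop ×ˢ 𝓝 (s, flow (P.fld i u) s t x)) := fun k =>
    ((tendsto_add_atTop_nat k).comp tendsto_fst).prodMk hpt
  choose r hr hle using fun j => he j s hs (flow (P.fld i u) s t x)
  have hr' : ∀ j k, Tendsto (fun q : (ℕ × ℝ × ℝ) × (ℕ × ℝ × ℝ) =>
      |r j ((q.1.1 + k, s, X q.1), (q.2.1 + k, s, X q.2))|) (L ×ˢ L) (𝓝 0) := by
    intro j k
    have := ((hr j).comp ((hq k).prodMap (hq k))).abs
    rw [abs_zero] at this
    exact this
  have hc : ∀ {p : (ℕ × ℝ × ℝ) × (ℕ × ℝ × ℝ) → ℕ × ℝ × ℝ}, Tendsto p (L ×ˢ L) L →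
      Tendsto (fun q => P.c' (hdiff (P.w (p q).1) s (X (p q)))) (L ×ˢ L)
        (𝓝 (P.c' (hdiff u s (flow (P.fld i u) s t x)))) := fun hp =>
    h.tendsto_deriv_speed (tendsto_fst.comp hp) (hXt.comp hp)
  refine ⟨fun q => P.K * P.N * |r i ((q.1.1 + 1, s, X q.1), (q.2.1 + 1, s, X q.2))| +
    (P.N * P.K + 1) * (|r true ((q.1.1 + 0, s, X q.1), (q.2.1 + 0, s, X q.2))| +
      |r false ((q.1.1 + 0, s, X q.1), (q.2.1 + 0, s, X q.2))|) +
    P.N * P.N * |P.c' (hdiff (P.w q.1.1) s (X q.1)) - P.c' (hdiff (P.w q.2.1) s (X q.2))|, ?_, ?_⟩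
  · have h1 := (((hr' i 1).const_mul (P.K * P.N)).add
      (((hr' true 0).add (hr' false 0)).const_mul (P.N * P.K + 1))).add
      (((hc tendsto_fst).sub (hc tendsto_snd)).abs.const_mul (P.N * P.N))
    simpa using h1
  · intro q
    have hK := P.K_nonneg
    have hN := P.N_nonneg
    set R := |r true ((q.1.1 + 0, s, X q.1), (q.2.1 + 0, s, X q.2))| +
      |r false ((q.1.1 + 0, s, X q.1), (q.2.1 + 0, s, X q.2))| with hR
    set R' := |r i ((q.1.1 + 1, s, X q.1), (q.2.1 + 1, s, X q.2))| with hR'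
    set Δ := |P.c' (hdiff (P.w q.1.1) s (X q.1)) - P.c' (hdiff (P.w q.2.1) s (X q.2))| with hΔ
    have e1 : |P.y (q.1.1 + 1) i s (X q.1) - P.y (q.2.1 + 1) i s (X q.2)| ≤ e s + R' :=
      (hle i ((q.1.1 + 1, s, X q.1), (q.2.1 + 1, s, X q.2))).trans (by gcongr; exact le_abs_self _)
    have e2 : ∀ j, |P.wx q.1.1 j s (X q.1) - P.wx q.2.1 j s (X q.2)| ≤ e s + R := by
      intro j
      refine (P.abs_wx_sub_le _ _ j _ _).trans
        ((hle j ((q.1.1 + 0, s, X q.1), (q.2.1 + 0, s, X q.2))).trans ?_)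
      gcongr
      have a1 := abs_nonneg (r true ((q.1.1 + 0, s, X q.1), (q.2.1 + 0, s, X q.2)))
      have a2 := abs_nonneg (r false ((q.1.1 + 0, s, X q.1), (q.2.1 + 0, s, X q.2)))
      cases j
      · linarith [le_abs_self (r false ((q.1.1 + 0, s, X q.1), (q.2.1 + 0, s, X q.2)))]
      · linarith [le_abs_self (r true ((q.1.1 + 0, s, X q.1), (q.2.1 + 0, s, X q.2)))]
    have e3 : |hdiff (P.wx q.1.1) s (X q.1) - hdiff (P.wx q.2.1) s (X q.2)| ≤ e s + R := by
      have := abs_hdiff_le (w := fun j (_ _ : ℝ) => P.wx q.1.1 j s (X q.1) - P.wx q.2.1 j s (X q.2))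
        (t := s) (x := 0) e2
      refine le_trans (le_of_eq ?_) this
      simp only [hdiff]
      congr 1
      ring
    have e4 : |P.fldx i (P.w q.1.1) (P.wx q.1.1) s (X q.1) -
        P.fldx i (P.w q.2.1) (P.wx q.2.1) s (X q.2)| ≤ P.K * (e s + R) + Δ * P.N := by
      have : P.fldx i (P.w q.1.1) (P.wx q.1.1) s (X q.1) -
          P.fldx i (P.w q.2.1) (P.wx q.2.1) s (X q.2) = sig i *
          (P.c' (hdiff (P.w q.1.1) s (X q.1)) *
              (hdiff (P.wx q.1.1) s (X q.1) - hdiff (P.wx q.2.1) s (X q.2)) +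
            (P.c' (hdiff (P.w q.1.1) s (X q.1)) - P.c' (hdiff (P.w q.2.1) s (X q.2))) *
              hdiff (P.wx q.2.1) s (X q.2)) := by
        simp only [fldx]
        ring
      rw [this, abs_mul, abs_sig, one_mul]
      refine (abs_add_le _ _).trans ?_
      rw [abs_mul, abs_mul]
      refine add_le_add (mul_le_mul (P.speed.abs_deriv_le _ (P.w_mem _ _ _)) e3 (abs_nonneg _) hK)
        (mul_le_mul_of_nonneg_left (abs_hdiff_le fun j => (P.decaying _ j).bddx _ _)
          (abs_nonneg _))
    have e5 : |P.src i q.1 s - P.src i q.2 s| ≤ P.K * P.N * (e s + R') +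
        (P.K * (e s + R) + Δ * P.N) * P.N + (e s + R) := by
      have : P.src i q.1 s - P.src i q.2 s =
          P.fldx i (P.w q.1.1) (P.wx q.1.1) s (X q.1) *
            (P.y (q.1.1 + 1) i s (X q.1) - P.y (q.2.1 + 1) i s (X q.2)) +
          (P.fldx i (P.w q.1.1) (P.wx q.1.1) s (X q.1) -
            P.fldx i (P.w q.2.1) (P.wx q.2.1) s (X q.2)) * P.y (q.2.1 + 1) i s (X q.2) +
          P.a s * (P.wx q.1.1 (!i) s (X q.1) - P.wx q.2.1 (!i) s (X q.2)) := by
        simp only [RiemannProblem.src, hX]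
        ring
      rw [this]
      refine (abs_add_le _ _).trans (add_le_add ((abs_add_le _ _).trans (add_le_add ?_ ?_)) ?_)
      · rw [abs_mul]
        exact mul_le_mul ((P.c1Field q.1.1 i).bddx _ _) e1 (abs_nonneg _) (mul_nonneg hK hN)
      · rw [abs_mul]
        exact mul_le_mul e4 (P.abs_y_le _ _ hs _) (abs_nonneg _) ((abs_nonneg _).trans e4)
      · rw [abs_mul, abs_of_nonneg (P.damping.nonneg s)]
        exact (mul_le_of_le_one_left (abs_nonneg _) (P.damping.le_one s)).trans (e2 _)
    refine e5.trans (le_of_eq ?_)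
    ring

end RiemannProblem

/-- Integrals of integrands that are asymptotically dominated pointwise are asymptotically
dominated. -/
lemma exists_tendsto_abs_integral_le {ι : Type*} {l : Filter ι} [l.IsCountablyGenerated]
    {F : ι → ℝ → ℝ} {e : ℝ → ℝ} {t C : ℝ} (ht : 0 ≤ t) (hF : ∀ q, Continuous (F q))
    (he : Continuous e) (hC : ∀ q, ∀ s ∈ Icc 0 t, |F q s| ≤ C)
    (h : ∀ s ∈ Icc 0 t, ∃ r : ι → ℝ, Tendsto r l (𝓝 0) ∧ ∀ q, |F q s| ≤ e s + r q) :
    ∃ r : ι → ℝ, Tendsto r l (𝓝 0) ∧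
      ∀ q, |∫ s in (0 : ℝ)..t, F q s| ≤ (∫ s in (0 : ℝ)..t, e s) + r q := by
  have hg : ∀ q, Continuous fun s => max (|F q s| - e s) 0 := fun q =>
    ((hF q).abs.sub he).max continuous_const
  refine ⟨fun q => ∫ s in (0 : ℝ)..t, max (|F q s| - e s) 0, ?_, ?_⟩
  · have hb : IntervalIntegrable (fun s => C + |e s|) volume 0 t :=
      (continuous_const.add he.abs).intervalIntegrable _ _
    suffices Tendsto (fun q => ∫ s in (0 : ℝ)..t, max (|F q s| - e s) 0) l
        (𝓝 (∫ _ in (0 : ℝ)..t, (0 : ℝ))) by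
      rwa [intervalIntegral.integral_zero] at this
    refine intervalIntegral.tendsto_integral_filter_of_dominated_convergence
      (fun s => C + |e s|) (Eventually.of_forall fun q => (hg q).aestronglyMeasurable)
      (Eventually.of_forall fun q => Eventually.of_forall fun s hs => ?_)
      hb (Eventually.of_forall fun s hs => ?_)
    · rw [uIoc_of_le ht] at hs
      have h1 := hC q s (Ioc_subset_Icc_self hs)
      have h2 := abs_nonneg (F q s)
      rw [Real.norm_eq_abs, abs_of_nonneg (le_max_right _ _)]
      exact max_le (by linarith [neg_abs_le (e s)]) (by linarith [abs_nonneg (e s)])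
    · rw [uIoc_of_le ht] at hs
      obtain ⟨r, hr, hle⟩ := h s (Ioc_subset_Icc_self hs)
      have hr' : Tendsto (fun q => |r q|) l (𝓝 0) := by simpa using hr.abs
      refine squeeze_zero (fun q => le_max_right _ _) (fun q => max_le ?_ (abs_nonneg _)) hr'
      linarith [hle q, le_abs_self (r q)]
  · intro q
    rw [← intervalIntegral.integral_add (he.intervalIntegrable _ _)
      ((hg q).intervalIntegrable _ _)]
    refine (intervalIntegral.abs_integral_le_integral_abs ht).trans
      (intervalIntegral.integral_mono_on ht ((hF q).abs.intervalIntegrable _ _)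
        ((he.add (hg q)).intervalIntegrable _ _) fun s _ => ?_)
    linarith [le_max_left (|F q s| - e s) 0]

lemma continuous_of_forall_tendsto {Z : Type*} [TopologicalSpace Z] {f : ℕ → Z → ℝ} {g : Z → ℝ}
    (h : ∀ z, Tendsto (fun q : ℕ × Z => f q.1 q.2) (atTop ×ˢ 𝓝 z) (𝓝 (g z))) : Continuous g := by
  refine continuous_iff_continuousAt.2 fun z => ?_
  rw [ContinuousAt, (closed_nhds_basis (g z)).tendsto_right_iff]
  rintro V ⟨hV, hVc⟩
  obtain ⟨pa, ha, pb, hb, hab⟩ := eventually_prod_iff.1 ((h z).eventually hV)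
  filter_upwards [hb] with z' hz'
  have h1 : Tendsto (fun n => f n z') atTop (𝓝 (g z')) :=
    (h z').comp (tendsto_id.prodMk (tendsto_const_pure.mono_right (pure_le_nhds z')))
  exact hVc.mem_of_tendsto h1 (ha.mono fun n hn => hab hn hz')

namespace RiemannProblem

variable {P : RiemannProblem} {u : Bool → ℝ → ℝ → ℝ} {η : ℕ → ℝ}

lemma abs_integral_src_le (i : Bool) (q : ℕ × ℝ × ℝ) {t : ℝ} (ht : t ∈ Icc 0 P.T) :
    |∫ s in t..P.clamp q.2.1, P.src i q s| ≤
      (P.K * P.N * P.N + P.N) * |P.clamp q.2.1 - t| :=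
  (Real.norm_eq_abs _).symm.le.trans <|
    intervalIntegral.norm_integral_le_of_norm_le_const fun _ hs =>
    P.abs_src_le i q (ordConnected_Icc.uIcc_subset ht (P.clamp_mem _) (uIoc_subset_uIcc hs))

lemma OscLE.step {e : ℝ → ℝ} (he : P.OscLE e) (hec : Continuous e) (h : P.IsLimit u η) :
    P.OscLE fun t => ∫ s in (0 : ℝ)..t, (2 * P.K * P.N + 1) * e s := by
  intro i t ht x
  set C := P.K * P.N * P.N + P.N with hCdef
  set L : Filter (ℕ × ℝ × ℝ) := atTop ×ˢ 𝓝 (t, x) with hL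
  obtain ⟨r, hr, hle⟩ := exists_tendsto_abs_integral_le (l := L ×ˢ L)
    (F := fun q s => P.src i q.1 s - P.src i q.2 s) (e := fun s => (2 * P.K * P.N + 1) * e s)
    (C := C + C) ht.1 (fun q => (P.continuous_src i q.1).sub (P.continuous_src i q.2))
    (continuous_const.mul hec)
    (fun q s hs => (abs_sub _ _).trans (add_le_add (P.abs_src_le i _ ⟨hs.1, hs.2.trans ht.2⟩)
      (P.abs_src_le i _ ⟨hs.1, hs.2.trans ht.2⟩)))
    (fun s hs => he.src h i ht ⟨hs.1, hs.2.trans ht.2⟩ x)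
  set d : ℕ × ℝ × ℝ → ℝ := fun q => P.w₀' i (flow (P.fld i (P.w q.1)) 0 (P.clamp q.2.1) q.2.2)
    with hd
  have hdt : Tendsto d L (𝓝 (P.w₀' i (flow (P.fld i u) 0 t x))) :=
    ((P.cont_w₀' i).tendsto _).comp (h.tendsto_char i ht 0 x)
  have hcl : Tendsto (fun q : ℕ × ℝ × ℝ => C * |P.clamp q.2.1 - t|) L (𝓝 0) := by
    have h1 := (P.continuous_clamp.comp (continuous_fst (X := ℝ) (Y := ℝ))).tendsto (t, x)
    simp only [Function.comp_apply, clamp_of_mem ht] at h1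
    have h2 := ((h1.comp tendsto_snd).sub_const t : Tendsto _ L _).abs.const_mul C
    simpa using h2
  have key : ∀ q : (ℕ × ℝ × ℝ) × (ℕ × ℝ × ℝ),
      |P.y (q.1.1 + 1) i q.1.2.1 q.1.2.2 - P.y (q.2.1 + 1) i q.2.2.1 q.2.2.2| ≤
        (∫ s in (0 : ℝ)..t, (2 * P.K * P.N + 1) * e s) +
          (|d q.1 - d q.2| + r q + C * |P.clamp q.1.2.1 - t| + C * |P.clamp q.2.2.1 - t|) := by
    intro q
    have e1 : ∀ p : ℕ × ℝ × ℝ, P.y (p.1 + 1) i p.2.1 p.2.2 = d p -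
        ((∫ s in (0 : ℝ)..t, P.src i p s) + ∫ s in t..P.clamp p.2.1, P.src i p s) := by
      intro p
      rw [intervalIntegral.integral_add_adjacent_intervals
        ((P.continuous_src i p).intervalIntegrable _ _)
        ((P.continuous_src i p).intervalIntegrable _ _)]
      exact P.y_succ_eq p.1 i p.2.1 p.2.2
    have e2 := hle q
    rw [intervalIntegral.integral_sub ((P.continuous_src i q.1).intervalIntegrable _ _)
      ((P.continuous_src i q.2).intervalIntegrable _ _)] at e2
    have e3 := abs_integral_src_le i q.1 ht
    have e4 := abs_integral_src_le i q.2 ht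
    have e5 := le_abs_self (d q.1 - d q.2)
    have e6 := neg_abs_le (d q.1 - d q.2)
    rw [e1 q.1, e1 q.2]
    rw [abs_le] at e2 e3 e4 ⊢
    constructor <;> linarith [e2.1, e2.2, e3.1, e3.2, e4.1, e4.2]
  set R : (ℕ × ℝ × ℝ) × (ℕ × ℝ × ℝ) → ℝ := fun q =>
    |d q.1 - d q.2| + r q + C * |P.clamp q.1.2.1 - t| + C * |P.clamp q.2.2.1 - t| with hR
  have hRt : Tendsto R (L ×ˢ L) (𝓝 0) := by
    have := ((((hdt.comp tendsto_fst).sub (hdt.comp tendsto_snd)).abs.add hr).add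
      (hcl.comp tendsto_fst)).add (hcl.comp tendsto_snd)
    simpa using this
  -- pass from `n` to `n - 1`
  set E := ∫ s in (0 : ℝ)..t, (2 * P.K * P.N + 1) * e s with hE
  refine ⟨fun q => max (|P.y q.1.1 i q.1.2.1 q.1.2.2 - P.y q.2.1 i q.2.2.1 q.2.2.2| - E) 0,
    ?_, fun q => sub_le_iff_le_add'.1 (le_max_left _ _)⟩
  have hpred : Tendsto (fun q : ℕ × ℝ × ℝ => (q.1 - 1, q.2)) L L :=
    ((tendsto_sub_atTop_nat 1).comp tendsto_fst).prodMk tendsto_snd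
  have hRt' : Tendsto (fun q => |R (Prod.map (fun q : ℕ × ℝ × ℝ => (q.1 - 1, q.2))
      (fun q : ℕ × ℝ × ℝ => (q.1 - 1, q.2)) q)|) (L ×ˢ L) (𝓝 0) := by
    have := (hRt.comp (hpred.prodMap hpred)).abs
    rw [abs_zero] at this
    exact this
  have hpos : ∀ᶠ q : ℕ × ℝ × ℝ in L, 1 ≤ q.1 := tendsto_fst.eventually (eventually_ge_atTop 1)
  refine squeeze_zero' (Eventually.of_forall fun q => le_max_right _ _) ?_ hRt'
  filter_upwards [hpos.prod_mk hpos] with q hq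
  have h1 := key ((q.1.1 - 1, q.1.2), (q.2.1 - 1, q.2.2))
  simp only [Nat.sub_add_cancel hq.1, Nat.sub_add_cancel hq.2] at h1
  refine max_le ?_ (abs_nonneg _)
  have h2 := le_abs_self (R ((q.1.1 - 1, q.1.2), (q.2.1 - 1, q.2.2)))
  have h3 : R ((q.1.1 - 1, q.1.2), (q.2.1 - 1, q.2.2)) = |d (q.1.1 - 1, q.1.2) -
    d (q.2.1 - 1, q.2.2)| + r ((q.1.1 - 1, q.1.2), (q.2.1 - 1, q.2.2)) +
    C * |P.clamp q.1.2.1 - t| + C * |P.clamp q.2.2.1 - t| := rfl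
  change _ ≤ |R ((q.1.1 - 1, q.1.2), (q.2.1 - 1, q.2.2))|
  linarith

lemma IsLimit.oscLE (h : P.IsLimit u η) (j : ℕ) :
    P.OscLE fun t => 2 * P.N * ((2 * P.K * P.N + 1) * t) ^ j / j.factorial := by
  induction j with
  | zero =>
    intro i t ht x
    refine ⟨fun q => max (|P.y q.1.1 i q.1.2.1 q.1.2.2 - P.y q.2.1 i q.2.2.1 q.2.2.2| - 2 * P.N) 0,
      ?_, fun q => ?_⟩
    · refine Tendsto.congr (fun q => ?_) tendsto_const_nhds
      rw [max_eq_right]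
      rw [sub_nonpos, ← P.y_clamp q.1.1, ← P.y_clamp q.2.1]
      have e1 := P.abs_y_le q.1.1 i (P.clamp_mem q.1.2.1) q.1.2.2
      have e2 := P.abs_y_le q.2.1 i (P.clamp_mem q.2.2.1) q.2.2.2
      exact (abs_sub _ _).trans ((add_le_add e1 e2).trans (two_mul _).symm.le)
    · simp only [pow_zero, mul_one, Nat.factorial_zero, Nat.cast_one, div_one]
      exact sub_le_iff_le_add'.1 (le_max_left _ _)
  | succ j ih =>
    have h1 := ih.step (by fun_prop) h
    convert h1 using 2 with t
    rw [intervalIntegral.integral_eq_sub_of_hasDerivAt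
      (fun s _ => hasDerivAt_pow_div_factorial _ _ j s)
      (Continuous.intervalIntegrable (by fun_prop) _ _)]
    simp

lemma IsLimit.exists_limit_y (h : P.IsLimit u η) (i : Bool) (t x : ℝ) :
    ∃ z, Tendsto (fun q : ℕ × ℝ × ℝ => P.y q.1 i q.2.1 q.2.2) (atTop ×ˢ 𝓝 (t, x)) (𝓝 z) := by
  suffices H : ∀ t ∈ Icc 0 P.T,
      ∃ z, Tendsto (fun q : ℕ × ℝ × ℝ => P.y q.1 i q.2.1 q.2.2) (atTop ×ˢ 𝓝 (t, x)) (𝓝 z) by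
    obtain ⟨z, hz⟩ := H (P.clamp t) (P.clamp_mem t)
    have h1 : Tendsto (fun q : ℕ × ℝ × ℝ => (q.1, P.clamp q.2.1, q.2.2)) (atTop ×ˢ 𝓝 (t, x))
        (atTop ×ˢ 𝓝 (P.clamp t, x)) :=
      tendsto_fst.prodMk ((((P.continuous_clamp.comp continuous_fst).prodMk
        continuous_snd).tendsto (t, x)).comp tendsto_snd)
    exact ⟨z, (hz.comp h1).congr fun q => P.y_clamp _ _ _ _⟩
  intro t ht
  refine cauchy_map_iff_exists_tendsto.1 ?_
  rw [cauchy_map_iff']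
  rw [Metric.uniformity_basis_dist.tendsto_right_iff]
  intro ε hε
  have h1 : Tendsto (fun j : ℕ => 2 * P.N * (((2 * P.K * P.N + 1) * t) ^ j / j.factorial)) atTop
      (𝓝 0) := by
    simpa using (FloorSemiring.tendsto_pow_div_factorial_atTop
      ((2 * P.K * P.N + 1) * t)).const_mul (2 * P.N)
  obtain ⟨j, hj⟩ := (h1.eventually (gt_mem_nhds (half_pos hε))).exists
  obtain ⟨r, hr, hle⟩ := h.oscLE j i t ht x
  filter_upwards [hr.eventually (gt_mem_nhds (half_pos hε))] with q hq
  have h2 := hle q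
  simp only [mul_div_assoc] at h2 hj
  rw [Real.dist_eq]
  linarith

lemma IsLimit.exists_limit_wx (h : P.IsLimit u η) (i : Bool) : ∃ p : ℝ → ℝ → ℝ, ∀ t x,
    Tendsto (fun q : ℕ × ℝ × ℝ => P.wx q.1 i q.2.1 q.2.2) (atTop ×ˢ 𝓝 (t, x)) (𝓝 (p t x)) := by
  choose z hz using h.exists_limit_y i
  refine ⟨fun t x => z t x / P.A (P.clamp t), fun t x => ?_⟩
  have h1 : Tendsto (fun q : ℕ × ℝ × ℝ => P.A (P.clamp q.2.1)) (atTop ×ˢ 𝓝 (t, x))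
      (𝓝 (P.A (P.clamp t))) :=
    ((P.damping.contA.comp (P.continuous_clamp.comp continuous_fst)).tendsto (t, x)).comp
      tendsto_snd
  refine ((hz t x).div h1 (P.damping.pos _).ne').congr fun q => ?_
  exact mul_div_cancel_left₀ _ (P.damping.pos _).ne'

end RiemannProblem

lemma hasDerivAt_of_tendsto_prod {f f' : ℕ → ℝ → ℝ} {g g' : ℝ → ℝ} {x : ℝ}
    (hf' : Tendsto (fun q : ℕ × ℝ => f' q.1 q.2) (atTop ×ˢ 𝓝 x) (𝓝 (g' x)))
    (hg' : ContinuousAt g' x)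
    (hf : ∀ᶠ q : ℕ × ℝ in atTop ×ˢ 𝓝 x, HasDerivAt (f q.1) (f' q.1 q.2) q.2)
    (hfg : ∀ y, Tendsto (fun n => f n y) atTop (𝓝 (g y))) : HasDerivAt g (g' x) x := by
  refine hasDerivAt_of_tendstoUniformlyOnFilter (l := atTop) ?_ hf (Eventually.of_forall hfg)
  rw [tendstoUniformlyOnFilter_iff_tendsto]
  have h1 : Tendsto (fun q : ℕ × ℝ => (g' q.2, f' q.1 q.2)) (atTop ×ˢ 𝓝 x)
      (𝓝 (g' x, g' x)) := (hg'.tendsto.comp tendsto_snd).prodMk_nhds hf'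
  exact h1.mono_right (nhds_le_uniformity (g' x))

namespace RiemannProblem

variable (P : RiemannProblem)

/-- `w` is a classical solution of the diagonal system with spatial derivatives `wx`. -/
structure IsSolution (w wx wt : Bool → ℝ → ℝ → ℝ) : Prop where
  spaceC1 : ∀ i, SpaceC1 (w i) (wx i)
  contt : ∀ i, Continuous fun p : ℝ × ℝ => wt i p.1 p.2
  time : ∀ i, ∀ t ∈ Ioo 0 P.T, ∀ x, HasDerivAt (fun t => w i t x) (wt i t x) t
  bdd : ∀ i t x, |w i t x| ≤ P.M
  bddx : ∀ i t x, |wx i t x| ≤ P.N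
  eq : ∀ i t x, wt i t x = -(P.fld i w t x * wx i t x) - P.a t / P.A t * (w i t x + w (!i) t x)
  init : ∀ i x, w i 0 x = P.w₀ i x

theorem exists_solution : ∃ w wx wt, P.IsSolution w wx wt := by
  obtain ⟨u, η, hη, hle⟩ := P.exists_limit
  have h : P.IsLimit u η := ⟨hη, hle⟩
  choose p hp using h.exists_limit_wx
  have hpc : ∀ i, Continuous fun z : ℝ × ℝ => p i z.1 z.2 := fun i =>
    continuous_of_forall_tendsto (f := fun n z => P.wx n i z.1 z.2) fun z => hp i z.1 z.2
  have hpt : ∀ i t x, Tendsto (fun n => P.wx n i t x) atTop (𝓝 (p i t x)) := fun i t x =>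
    (hp i t x).comp (tendsto_id.prodMk (tendsto_const_pure.mono_right (pure_le_nhds (t, x))))
  set ut : Bool → ℝ → ℝ → ℝ := fun i t x =>
    -(P.fld i u t x * p i t x) - P.a t / P.A t * (u i t x + u (!i) t x) with hut
  have hfc : ∀ i, Continuous fun z : ℝ × ℝ => P.fld i u z.1 z.2 := fun i => (h.lipField i).cont
  have hac : Continuous fun t => P.a t / P.A t :=
    P.damping.conta.div P.damping.contA fun t => (P.damping.pos t).ne'
  have hutc : ∀ i, Continuous fun z : ℝ × ℝ => ut i z.1 z.2 := fun i =>
    ((hfc i).mul (hpc i)).neg.sub ((hac.comp continuous_fst).mul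
      ((h.continuous i).add (h.continuous (!i))))
  refine ⟨u, p, ut, fun i => ⟨h.continuous i, hpc i, fun t x => ?_⟩, hutc, fun i t ht x => ?_,
    h.abs_le, fun i t x => ?_, fun i t x => rfl, fun i x => ?_⟩
  · have h1 : Tendsto (fun q : ℕ × ℝ => (q.1, t, q.2)) (atTop ×ˢ 𝓝 x) (atTop ×ˢ 𝓝 (t, x)) :=
      tendsto_fst.prodMk (tendsto_const_nhds.prodMk_nhds tendsto_snd)
    exact hasDerivAt_of_tendsto_prod (f' := fun n x => P.wx n i t x) (g' := p i t)
      ((hp i t x).comp h1)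
      ((hpc i).comp (continuous_const.prodMk continuous_id)).continuousAt
      (Eventually.of_forall fun q => (P.decaying q.1 i).hasDerivAt t q.2)
      fun y => h.tendsto_w i t y
  · have h1 : Tendsto (fun q : ℕ × ℝ => (q.1, q.2, x)) (atTop ×ˢ 𝓝 t) (atTop ×ˢ 𝓝 (t, x)) :=
      tendsto_fst.prodMk (tendsto_snd.prodMk_nhds tendsto_const_nhds)
    have h1' : Tendsto (fun q : ℕ × ℝ => (q.2, x)) (atTop ×ˢ 𝓝 t) (𝓝 (t, x)) :=
      tendsto_snd.prodMk_nhds tendsto_const_nhds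
    have hn : Tendsto (fun q : ℕ × ℝ => q.1 - 1) (atTop ×ˢ 𝓝 t) atTop :=
      (tendsto_sub_atTop_nat 1).comp tendsto_fst
    have hw : ∀ j {n : ℕ × ℝ → ℕ}, Tendsto n (atTop ×ˢ 𝓝 t) atTop →
        Tendsto (fun q => P.w (n q) j q.2 x) (atTop ×ˢ 𝓝 t) (𝓝 (u j t x)) := by
      intro j n hn
      have h3 : Tendsto (fun q : ℕ × ℝ => P.w (n q) j q.2 x - u j q.2 x) (atTop ×ˢ 𝓝 t) (𝓝 0) :=
        squeeze_zero_norm (fun q => hle (n q) j q.2 x) (hη.comp hn)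
      simpa using h3.add (((h.continuous j).tendsto (t, x)).comp h1')
    have hf : Tendsto (fun q : ℕ × ℝ => P.fld i (P.w (q.1 - 1)) q.2 x) (atTop ×ˢ 𝓝 t)
        (𝓝 (P.fld i u t x)) := by
      have h3 : Tendsto (fun q : ℕ × ℝ => P.fld i (P.w (q.1 - 1)) q.2 x - P.fld i u q.2 x)
          (atTop ×ˢ 𝓝 t) (𝓝 0) :=
        squeeze_zero_norm (fun q => h.abs_fld_sub_le i (q.1 - 1) q.2 x)
          (h.tendsto_K_mul.comp hn)
      simpa using h3.add (((hfc i).tendsto (t, x)).comp h1')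
    refine hasDerivAt_of_tendsto_prod (f' := fun n t => P.wt n i t x) (g' := fun t => ut i t x)
      (((hf.mul ((hp i t x).comp h1)).neg).sub (((hac.tendsto t).comp tendsto_snd).mul
        ((hw i tendsto_fst).add (hw (!i) hn))))
      ((hutc i).comp (continuous_id.prodMk continuous_const)).continuousAt ?_
      fun y => h.tendsto_w i y x
    filter_upwards [tendsto_snd.eventually (isOpen_Ioo.mem_nhds ht)] with q hq
    exact (P.decaying q.1 i).time q.2 hq x
  · exact le_of_tendsto (hpt i t x).abs
      (Eventually.of_forall fun n => (P.decaying n i).bddx t x)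
  · refine tendsto_nhds_unique (h.tendsto_w i 0 x) (tendsto_const_nhds.congr' ?_)
    filter_upwards [eventually_ge_atTop 1] with n hn
    obtain ⟨m, rfl⟩ := Nat.exists_eq_add_of_le' hn
    exact (P.w_zero_time m i x).symm

end RiemannProblem

lemma contDiffOn_of_hasDerivAt_partials {f ft fx : ℝ → ℝ → ℝ} {S : Set (ℝ × ℝ)} (hS : IsOpen S)
    (ht : ∀ p ∈ S, HasDerivAt (fun t => f t p.2) (ft p.1 p.2) p.1)
    (hx : ∀ p ∈ S, HasDerivAt (fun x => f p.1 x) (fx p.1 p.2) p.2)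
    (hct : Continuous fun p : ℝ × ℝ => ft p.1 p.2) (hcx : Continuous fun p : ℝ × ℝ => fx p.1 p.2) :
    ContDiffOn ℝ 1 (fun p : ℝ × ℝ => f p.1 p.2) S := by
  set f₁ : ℝ → ℝ → ℝ →L[ℝ] ℝ := fun t x => ContinuousLinearMap.toSpanSingleton ℝ (ft t x)
  set f₂ : ℝ → ℝ → ℝ →L[ℝ] ℝ := fun t x => ContinuousLinearMap.toSpanSingleton ℝ (fx t x)
  have hc : ∀ {g : ℝ × ℝ → ℝ}, Continuous g →
      Continuous fun p => ContinuousLinearMap.toSpanSingleton ℝ (g p) := fun hg =>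
    (ContinuousLinearMap.toSpanSingletonCLE (𝕜 := ℝ) (E := ℝ)).continuous.comp hg
  have hc₁ : Continuous fun p : ℝ × ℝ => f₁ p.1 p.2 := hc hct
  have hc₂ : Continuous fun p : ℝ × ℝ => f₂ p.1 p.2 := hc hcx
  have hD : ∀ p ∈ S, HasFDerivAt (fun p : ℝ × ℝ => f p.1 p.2)
      ((f₁ p.1 p.2).coprod (f₂ p.1 p.2)) p := fun p hp =>
    (hasStrictFDerivAt_uncurry_coprod (f := f) (f₁ := f₁) (f₂ := f₂)
      (by filter_upwards [hS.mem_nhds hp] with q hq using (ht q hq).hasFDerivAt)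
      (by filter_upwards [hS.mem_nhds hp] with q hq using (hx q hq).hasFDerivAt)
      hc₁.continuousAt hc₂.continuousAt).hasFDerivAt
  rw [show (1 : WithTop ℕ∞) = 0 + 1 from rfl,
    contDiffOn_succ_iff_hasFDerivWithinAt_of_uniqueDiffOn hS.uniqueDiffOn]
  refine ⟨by simp, fun p => (f₁ p.1 p.2).coprod (f₂ p.1 p.2), ?_,
    fun p hp => (hD p hp).hasFDerivWithinAt⟩
  rw [contDiffOn_zero]
  exact ((hc₁.clm_comp (continuous_const (y := ContinuousLinearMap.fst ℝ ℝ ℝ))).add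
    (hc₂.clm_comp (continuous_const (y := ContinuousLinearMap.snd ℝ ℝ ℝ)))).continuousOn.congr
    fun p _ => by ext <;> simp

/-- Odd reflection at `0` preserves differentiability. -/
lemma hasDerivAt_odd_extension {f f' : ℝ → ℝ} {T t : ℝ} (hf : Continuous f) (hf' : Continuous f')
    (h : ∀ t ∈ Ioo 0 T, HasDerivAt f (f' t) t) (ht : t ∈ Ioo (-T) T) :
    HasDerivAt (fun t => f (max t 0) + f 0 - f (max (-t) 0)) (f' |t|) t := by
  have hc : Continuous fun s => f' |s| := hf'.comp continuous_abs
  have hpos : ∀ s ∈ Ico 0 T, ∫ r in (0 : ℝ)..s, f' |r| = f s - f 0 := by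
    intro s hs
    rw [← intervalIntegral.integral_eq_sub_of_hasDerivAt_of_le hs.1 hf.continuousOn
      (fun r hr => h r ⟨hr.1, hr.2.trans hs.2⟩) (hf'.intervalIntegrable _ _)]
    refine intervalIntegral.integral_congr fun r hr => ?_
    rw [uIcc_of_le hs.1] at hr
    simp only [abs_of_nonneg hr.1]
  have h1 := (intervalIntegral.integral_hasDerivAt_right (hc.intervalIntegrable 0 t)
    (hc.stronglyMeasurableAtFilter _ _) hc.continuousAt).const_add (f 0)
  refine h1.congr_of_eventuallyEq ?_
  filter_upwards [isOpen_Ioo.mem_nhds ht] with s hs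
  rcases le_total 0 s with h0 | h0
  · rw [max_eq_left h0, max_eq_right (neg_nonpos.2 h0), hpos s ⟨h0, hs.2⟩]
    ring
  · have h2 : ∫ r in (0 : ℝ)..s, f' |r| = -∫ r in (0 : ℝ)..-s, f' |r| := by
      have := intervalIntegral.integral_comp_neg (a := 0) (b := s) fun r => f' |r|
      simp only [abs_neg, neg_zero] at this
      rw [this, intervalIntegral.integral_symm]
    rw [max_eq_right h0, max_eq_left (neg_nonneg.2 h0), h2,
      hpos (-s) ⟨neg_nonneg.2 h0, by linarith [hs.1]⟩]
    ring

namespace RiemannProblem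

variable (P : RiemannProblem)

/-- `w` is a classical solution of the diagonal system which extends to negative times. -/
structure IsClassicalSolution (w wx : Bool → ℝ → ℝ → ℝ) : Prop where
  contDiffOn : ∀ i, ContDiffOn ℝ 1 (fun p : ℝ × ℝ => w i p.1 p.2) (Ioo (-P.T) P.T ×ˢ univ)
  space : ∀ i, ∀ t ∈ Ico 0 P.T, ∀ x, HasDerivAt (fun x => w i t x) (wx i t x) x
  time : ∀ i, ∀ t ∈ Ico 0 P.T, ∀ x, HasDerivAt (fun t => w i t x)
    (-(P.fld i w t x * wx i t x) - P.a t / P.A t * (w i t x + w (!i) t x)) t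
  bdd : ∀ i, ∀ t ∈ Ico 0 P.T, ∀ x, |w i t x| ≤ P.M
  bddx : ∀ i, ∀ t ∈ Ico 0 P.T, ∀ x, |wx i t x| ≤ P.N
  init : ∀ i x, w i 0 x = P.w₀ i x

theorem exists_classicalSolution : ∃ w wx, P.IsClassicalSolution w wx := by
  obtain ⟨w, wx, wt, h⟩ := P.exists_solution
  set W : Bool → ℝ → ℝ → ℝ := fun i t x => w i (max t 0) x + w i 0 x - w i (max (-t) 0) x with hW
  have hWt : ∀ i, ∀ t, 0 ≤ t → ∀ x, W i t x = w i t x := by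
    intro i t ht x
    simp only [hW, max_eq_left ht, max_eq_right (neg_nonpos.2 ht)]
    ring
  have hdt : ∀ i, ∀ t ∈ Ioo (-P.T) P.T, ∀ x,
      HasDerivAt (fun t => W i t x) (wt i |t| x) t := fun i t ht x =>
    hasDerivAt_odd_extension (f := fun t => w i t x) (f' := fun t => wt i t x)
      ((h.spaceC1 i).cont.comp (continuous_id.prodMk continuous_const))
      ((h.contt i).comp (continuous_id.prodMk continuous_const)) (fun t ht => h.time i t ht x) ht
  refine ⟨W, wx, fun i => ?_, fun i t ht x => ?_, fun i t ht x => ?_, fun i t ht x => ?_,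
    fun i t _ x => h.bddx i t x, fun i x => ?_⟩
  · have hcx := (h.spaceC1 i).contx
    refine contDiffOn_of_hasDerivAt_partials (f := W i) (ft := fun t x => wt i |t| x)
      (fx := fun t x => wx i (max t 0) x + wx i 0 x - wx i (max (-t) 0) x)
      (isOpen_Ioo.prod isOpen_univ) (fun p hp => hdt i p.1 hp.1 p.2) (fun p _ => ?_)
      ((h.contt i).comp₂ continuous_fst.abs continuous_snd) ?_
    · exact (((h.spaceC1 i).hasDerivAt _ _).add ((h.spaceC1 i).hasDerivAt _ _)).sub
        ((h.spaceC1 i).hasDerivAt _ _)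
    · exact ((hcx.comp₂ (by fun_prop) (by fun_prop)).add
        (hcx.comp₂ (by fun_prop) (by fun_prop))).sub
        (hcx.comp₂ (by fun_prop) (by fun_prop))
  · simp only [hWt i t ht.1]
    exact (h.spaceC1 i).hasDerivAt t x
  · refine (hdt i t ⟨by linarith [ht.1, ht.2], ht.2⟩ x).congr_deriv ?_
    simp only [fld, hdiff, hWt _ t ht.1, abs_of_nonneg ht.1, h.eq]
  · rw [hWt i t ht.1]
    exact h.bdd i t x
  · rw [hWt i 0 le_rfl]
    exact h.init i x

end RiemannProblem

lemma damping_rpow {m : ℝ} (hm0 : 0 ≤ m) (hm1 : m < 1) :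
    Damping (fun t => (1 + |t|) ^ m) (fun t => m * (1 + |t|) ^ (m - 1))
      (fun t => m * (m - 1) * (1 + |t|) ^ (m - 2)) (fun t => (1 + |t|) ^ (m - 2))
      (1 / (1 - m)) := by
  have hpos : ∀ t : ℝ, 0 < 1 + |t| := fun t => by positivity
  have hone : ∀ t : ℝ, 1 ≤ 1 + |t| := fun t => by linarith [abs_nonneg t]
  have hc : ∀ z : ℝ, Continuous fun t : ℝ => (1 + |t|) ^ z := fun z =>
    (continuous_const.add continuous_abs).rpow_const fun t => Or.inl (hpos t).ne'
  have hd : ∀ z t : ℝ, 0 < t → HasDerivAt (fun t : ℝ => (1 + |t|) ^ z)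
      (z * (1 + |t|) ^ (z - 1)) t := by
    intro z t ht
    have h1 := ((hasDerivAt_abs_pos ht).const_add 1).rpow_const (p := z) (Or.inl (hpos t).ne')
    refine h1.congr_deriv (by ring)
  refine ⟨hc _, continuous_const.mul (hc _), continuous_const.mul (hc _), hc _, by simp,
    fun t => one_le_rpow (hone t) hm0, fun t ht => hd m t ht, fun t ht => ?_, fun t => ?_,
    fun t => ?_, fun t => ?_, fun t => ?_, fun t ht => ?_⟩
  · refine ((hd (m - 1) t ht).const_mul m).congr_deriv ?_
    rw [show m - 1 - 1 = m - 2 by ring]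
    ring
  · exact mul_nonneg hm0 (rpow_nonneg (hpos t).le _)
  · exact mul_le_one₀ hm1.le (rpow_nonneg (hpos t).le _)
      (rpow_le_one_of_one_le_of_nonpos (hone t) (by linarith))
  · rw [abs_mul, abs_of_nonneg (rpow_nonneg (hpos t).le (m - 2))]
    refine mul_le_of_le_one_left (rpow_nonneg (hpos t).le _) ?_
    rw [abs_le]
    constructor <;> nlinarith
  · have e : m * (1 + |t|) ^ (m - 1) * (m * (1 + |t|) ^ (m - 1) / (1 + |t|) ^ m) =
        m * m * (1 + |t|) ^ (m - 2) := by
      rw [show m - 2 = (m - 1) + (m - 1) - m by ring, rpow_sub (hpos t) (m - 1 + (m - 1)) m,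
        rpow_add (hpos t)]
      ring
    rw [e]
    exact mul_le_of_le_one_left (rpow_nonneg (hpos t).le _) (by nlinarith)
  · have hm : m - 1 ≠ 0 := by linarith
    have h1 := intervalIntegral.integral_eq_sub_of_hasDerivAt_of_le ht
      ((hc (m - 1)).div_const (m - 1)).continuousOn
      (f' := fun t => (1 + |t|) ^ (m - 2))
      (fun s hs => ((hd (m - 1) s hs.1).div_const (m - 1)).congr_deriv (by
        rw [show m - 1 - 1 = m - 2 by ring]
        field_simp))
      ((hc _).intervalIntegrable _ _)
    rw [h1, abs_zero, add_zero, one_rpow, ← sub_div, ← neg_div_neg_eq, neg_sub, neg_sub]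
    refine div_le_div_of_nonneg_right ?_ (by linarith)
    linarith [rpow_nonneg (hpos t).le (m - 1)]

lemma integral_one_div_rpow_le {m T : ℝ} (hm1 : m < 1) (hT : 0 ≤ T) :
    ∫ s in (0 : ℝ)..T, 1 / (1 + |s|) ^ m ≤ (1 + T) ^ (1 - m) / (1 - m) := by
  have hpos : ∀ t : ℝ, 0 < 1 + |t| := fun t => by positivity
  have hc : ∀ z : ℝ, Continuous fun t : ℝ => (1 + |t|) ^ z := fun z =>
    (continuous_const.add continuous_abs).rpow_const fun t => Or.inl (hpos t).ne'
  have hm : 1 - m ≠ 0 := by linarith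
  have h1 := intervalIntegral.integral_eq_sub_of_hasDerivAt_of_le hT
    ((hc (1 - m)).div_const (1 - m)).continuousOn
    (f' := fun t => 1 / (1 + |t|) ^ m)
    (fun s hs => ?_)
    ((continuous_const.div (hc m) fun t => (rpow_pos_of_pos (hpos t) m).ne').intervalIntegrable _ _)
  · rw [h1, abs_zero, add_zero, one_rpow, abs_of_nonneg hT]
    have : 0 ≤ 1 / (1 - m) := by
      have : 0 < 1 - m := by linarith
      positivity
    linarith
  · have h2 := (((hasDerivAt_abs_pos hs.1).const_add 1).rpow_const (p := 1 - m)
      (Or.inl (hpos s).ne')).div_const (1 - m)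
    refine h2.congr_deriv ?_
    rw [show 1 - m - 1 = -m by ring, rpow_neg (hpos s).le]
    field_simp

section PowerLaw

variable {γ : ℝ}

/-- The affine function `1 - (γ - 1) k / 2`, equal to `u ^ (-(γ - 1) / 2)`. -/
def gasBase (γ k : ℝ) : ℝ := 1 - (γ - 1) * k / 2

lemma gasBase_mem (hγ : 1 < γ) {k : ℝ} (hk : k ∈ Icc (-(1 / (γ - 1))) (1 / (γ - 1))) :
    gasBase γ k ∈ Icc (1 / 2) (3 / 2) := by
  have h0 : 0 < γ - 1 := by linarith
  have h1 : (γ - 1) * k ≤ 1 := by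
    have := mul_le_mul_of_nonneg_left hk.2 h0.le
    rwa [mul_one_div_cancel h0.ne'] at this
  have h2 : -1 ≤ (γ - 1) * k := by
    have := mul_le_mul_of_nonneg_left hk.1 h0.le
    rwa [mul_neg, mul_one_div_cancel h0.ne'] at this
  constructor <;> simp only [gasBase] <;> linarith

lemma gasBase_pos (hγ : 1 < γ) {k : ℝ} (hk : k ∈ Icc (-(1 / (γ - 1))) (1 / (γ - 1))) :
    0 < gasBase γ k := lt_of_lt_of_le (by norm_num) (gasBase_mem hγ hk).1

lemma hasDerivAt_gasBase (γ k : ℝ) : HasDerivAt (gasBase γ) (-((γ - 1) / 2)) k := by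
  have h := (((hasDerivAt_id k).const_mul (γ - 1)).div_const 2).const_sub 1
  exact h.congr_deriv (by ring)

lemma hasDerivAt_gasBase_rpow (hγ : 1 < γ) {k : ℝ}
    (hk : k ∈ Icc (-(1 / (γ - 1))) (1 / (γ - 1))) (z : ℝ) :
    HasDerivAt (fun k => gasBase γ k ^ z) (-((γ - 1) / 2) * z * gasBase γ k ^ (z - 1)) k :=
  (hasDerivAt_gasBase γ k).rpow_const (Or.inl (ne_of_gt (gasBase_pos hγ hk)))

/-- The wave speed as a function of half the difference of the Riemann invariants. -/
def gasSpeed (γ k : ℝ) : ℝ := gasBase γ k ^ ((γ + 1) / (γ - 1))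

/-- The derivative of `gasSpeed`. -/
def gasSpeedDeriv (γ k : ℝ) : ℝ := -((γ + 1) / 2) * gasBase γ k ^ (2 / (γ - 1))

/-- The specific volume as a function of half the difference of the Riemann invariants. -/
def gasVolume (γ k : ℝ) : ℝ := gasBase γ k ^ (-2 / (γ - 1))

lemma speed_gasSpeed (hγ : 1 < γ) : Speed (gasSpeed γ) (gasSpeedDeriv γ) (1 / (γ - 1))
    ((1 / 2) ^ ((γ + 1) / (γ - 1))) ((3 / 2) ^ ((γ + 1) / (γ - 1)))
    ((γ + 1) / 2 * (3 / 2) ^ (2 / (γ - 1))) := by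
  have h0 : 0 < γ - 1 := by linarith
  have he : 0 ≤ (γ + 1) / (γ - 1) := div_nonneg (by linarith) h0.le
  have hz : 0 ≤ 2 / (γ - 1) := div_nonneg (by norm_num) h0.le
  refine ⟨fun k hk => ?_, ?_, by positivity, fun k hk => ?_, fun k hk => ?_, fun k hk => ?_⟩
  · refine (hasDerivAt_gasBase_rpow hγ hk _).congr_deriv ?_
    rw [gasSpeedDeriv, show (γ + 1) / (γ - 1) - 1 = 2 / (γ - 1) by field_simp; ring]
    field_simp
  · exact continuousOn_const.mul (ContinuousOn.rpow_const
      (fun k _ => (hasDerivAt_gasBase γ k).continuousAt.continuousWithinAt)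
      fun k hk => Or.inl (gasBase_pos hγ hk).ne')
  · exact rpow_le_rpow (by norm_num) (gasBase_mem hγ hk).1 he
  · exact rpow_le_rpow (gasBase_pos hγ hk).le (gasBase_mem hγ hk).2 he
  · rw [gasSpeedDeriv, abs_mul, abs_neg, abs_of_nonneg (by linarith : 0 ≤ (γ + 1) / 2),
      abs_of_nonneg (rpow_nonneg (gasBase_pos hγ hk).le _)]
    exact mul_le_mul_of_nonneg_left
      (rpow_le_rpow (gasBase_pos hγ hk).le (gasBase_mem hγ hk).2 hz) (by linarith)

lemma hasDerivAt_gasVolume (hγ : 1 < γ) {k : ℝ} (hk : k ∈ Icc (-(1 / (γ - 1))) (1 / (γ - 1))) :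
    HasDerivAt (gasVolume γ) (1 / gasSpeed γ k) k := by
  have h0 : 0 < γ - 1 := by linarith
  refine (hasDerivAt_gasBase_rpow hγ hk _).congr_deriv ?_
  rw [gasSpeed, show -2 / (γ - 1) - 1 = -((γ + 1) / (γ - 1)) by field_simp; ring,
    rpow_neg (gasBase_pos hγ hk).le]
  field_simp

lemma gasVolume_pos (hγ : 1 < γ) {k : ℝ} (hk : k ∈ Icc (-(1 / (γ - 1))) (1 / (γ - 1))) :
    0 < gasVolume γ k := rpow_pos_of_pos (gasBase_pos hγ hk) _

lemma gasVolume_le (hγ : 1 < γ) {k : ℝ} (hk : k ∈ Icc (-(1 / (γ - 1))) (1 / (γ - 1))) :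
    gasVolume γ k ≤ (1 / 2) ^ (-2 / (γ - 1)) :=
  rpow_le_rpow_of_nonpos (by norm_num) (gasBase_mem hγ hk).1
    (div_nonpos_of_nonpos_of_nonneg (by norm_num) (by linarith))

lemma hasDerivAt_pres_gasVolume (hγ : 1 < γ) {k : ℝ}
    (hk : k ∈ Icc (-(1 / (γ - 1))) (1 / (γ - 1))) :
    HasDerivAt (fun k => gasVolume γ k ^ (-γ) / γ) (-gasSpeed γ k) k := by
  have h0 : 0 < γ - 1 := by linarith
  have hb := gasBase_pos hγ hk
  have h1 := ((hasDerivAt_gasVolume hγ hk).rpow_const (p := -γ)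
    (Or.inl (gasVolume_pos hγ hk).ne')).div_const γ
  refine h1.congr_deriv ?_
  have e : gasVolume γ k ^ (-γ - 1) = gasSpeed γ k * gasSpeed γ k := by
    rw [gasVolume, gasSpeed, ← rpow_mul hb.le, ← rpow_add hb]
    congr 1
    field_simp
    ring
  have hs : gasSpeed γ k ≠ 0 := (rpow_pos_of_pos hb _).ne'
  rw [e]
  field_simp

lemma contDiffOn_gasVolume (hγ : 1 < γ) :
    ContDiffOn ℝ 1 (gasVolume γ) (Icc (-(1 / (γ - 1))) (1 / (γ - 1))) := by
  refine ContDiffOn.rpow_const_of_ne ?_ fun k hk => (gasBase_pos hγ hk).ne'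
  unfold gasBase
  fun_prop

/-- Half the difference of the Riemann invariants as a function of the specific volume. -/
def gasInv (γ u : ℝ) : ℝ := 2 / (γ - 1) * (1 - u ^ (-(γ - 1) / 2))

lemma gasVolume_gasInv (hγ : 1 < γ) {u : ℝ} (hu : 0 < u) : gasVolume γ (gasInv γ u) = u := by
  have h0 : γ - 1 ≠ 0 := by linarith
  have e : gasBase γ (gasInv γ u) = u ^ (-(γ - 1) / 2) := by
    rw [gasBase, gasInv]
    field_simp
    ring
  rw [gasVolume, e, ← rpow_mul hu.le]
  convert rpow_one u using 2
  field_simp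

lemma hasDerivAt_gasInv (hγ : 1 < γ) {u : ℝ} (hu : 0 < u) :
    HasDerivAt (gasInv γ) (u ^ (-(γ + 1) / 2)) u := by
  have h0 : γ - 1 ≠ 0 := by linarith
  have h1 := ((hasDerivAt_rpow_const (p := -(γ - 1) / 2) (Or.inl hu.ne')).const_sub 1).const_mul
    (2 / (γ - 1))
  refine h1.congr_deriv ?_
  rw [show -(γ - 1) / 2 - 1 = -(γ + 1) / 2 by ring]
  field_simp

lemma gasInv_one (γ : ℝ) : gasInv γ 1 = 0 := by simp [gasInv]

lemma rpow_gasInv_deriv_le (hγ : 1 < γ) {u : ℝ} (hu : 1 / 2 ≤ u) :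
    |u ^ (-(γ + 1) / 2)| ≤ (1 / 2) ^ (-(γ + 1) / 2) := by
  rw [abs_of_nonneg (rpow_nonneg (by linarith) _)]
  exact rpow_le_rpow_of_nonpos (by norm_num) hu (by linarith)

lemma abs_gasInv_le (hγ : 1 < γ) {u : ℝ} (hu : 1 / 2 ≤ u) :
    |gasInv γ u| ≤ (1 / 2) ^ (-(γ + 1) / 2) * |u - 1| := by
  have h := Convex.norm_image_sub_le_of_norm_hasDerivWithin_le (s := Ici (1 / 2 : ℝ))
    (fun s hs => (hasDerivAt_gasInv hγ (lt_of_lt_of_le (by norm_num) hs)).hasDerivWithinAt)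
    (fun s hs => rpow_gasInv_deriv_le hγ hs) (convex_Ici _)
    (by norm_num : (1 : ℝ) ∈ Ici (1 / 2 : ℝ)) hu
  simpa [Real.norm_eq_abs, gasInv_one] using h

end PowerLaw

namespace RiemannProblem

/-- Classical solutions of the diagonal system yield solutions of the damped Euler system. -/
theorem IsClassicalSolution.exists_euler {P : RiemannProblem} {w wx : Bool → ℝ → ℝ → ℝ}
    (h : P.IsClassicalSolution w wx) {γ lam T : ℝ} (hγ : 1 < γ) (hT : T < P.T)
    (hM : P.M ≤ 1 / (γ - 1)) (hc : P.c = gasSpeed γ)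
    (ha : ∀ t, 0 ≤ t → P.a t / P.A t = lam / 2 / (1 + t)) :
    IsC1bOn (fun t x => gasVolume γ (hdiff w t x)) (strip T) ∧
    IsC1bOn (fun t x => (w true t x + w false t x) / 2) (strip T) ∧
    IsEulerOn γ lam 1 (fun t x => gasVolume γ (hdiff w t x))
      (fun t x => (w true t x + w false t x) / 2) (strip T) ∧
    ∀ p ∈ strip T, 0 < gasVolume γ (hdiff w p.1 p.2) := by
  set I := Icc (-(1 / (γ - 1))) (1 / (γ - 1)) with hI
  have hmem : ∀ t ∈ Icc 0 T, ∀ x, hdiff w t x ∈ I := by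
    intro t ht x
    have h1 := h.bdd true t ⟨ht.1, ht.2.trans_lt hT⟩ x
    have h2 := h.bdd false t ⟨ht.1, ht.2.trans_lt hT⟩ x
    refine abs_le.1 (le_trans (abs_hdiff_le (M := P.M) fun i => ?_) hM)
    cases i <;> assumption
  have hsub : strip T ⊆ Ioo (-P.T) P.T ×ˢ univ := fun p hp =>
    ⟨⟨by linarith [hp.1.1, hp.1.2], hp.1.2.trans_lt hT⟩, trivial⟩
  have hC : ∀ i, ContDiffOn ℝ 1 (fun p : ℝ × ℝ => w i p.1 p.2) (strip T) := fun i =>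
    (h.contDiffOn i).mono hsub
  have hcpos : ∀ t ∈ Icc 0 T, ∀ x, 0 < gasSpeed γ (hdiff w t x) := fun t ht x =>
    rpow_pos_of_pos (gasBase_pos hγ (hmem t ht x)) _
  have hkx : ∀ t ∈ Icc 0 T, ∀ x, HasDerivAt (fun x => hdiff w t x) (hdiff wx t x) x :=
    fun t ht x => ((h.space true t ⟨ht.1, ht.2.trans_lt hT⟩ x).sub
      (h.space false t ⟨ht.1, ht.2.trans_lt hT⟩ x)).div_const 2
  have hkt : ∀ t ∈ Icc 0 T, ∀ x, HasDerivAt (fun t => hdiff w t x)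
      (gasSpeed γ (hdiff w t x) * ((wx true t x + wx false t x) / 2)) t := by
    intro t ht x
    refine (((h.time true t ⟨ht.1, ht.2.trans_lt hT⟩ x).sub
      (h.time false t ⟨ht.1, ht.2.trans_lt hT⟩ x)).div_const 2).congr_deriv ?_
    simp only [fld, sig, hc, Bool.not_true, Bool.not_false]
    ring
  have hvx : ∀ t ∈ Icc 0 T, ∀ x, pdx (fun t x => (w true t x + w false t x) / 2) t x =
      (wx true t x + wx false t x) / 2 := fun t ht x =>
    (((h.space true t ⟨ht.1, ht.2.trans_lt hT⟩ x).add
      (h.space false t ⟨ht.1, ht.2.trans_lt hT⟩ x)).div_const 2).deriv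
  have hvt : ∀ t ∈ Icc 0 T, ∀ x, pdt (fun t x => (w true t x + w false t x) / 2) t x =
      gasSpeed γ (hdiff w t x) * hdiff wx t x -
        lam / (1 + t) * ((w true t x + w false t x) / 2) := by
    intro t ht x
    refine ((((h.time true t ⟨ht.1, ht.2.trans_lt hT⟩ x).add
      (h.time false t ⟨ht.1, ht.2.trans_lt hT⟩ x)).div_const 2).congr_deriv ?_).deriv
    simp only [fld, sig, hc, Bool.not_true, Bool.not_false, ha t ht.1]
    simp only [hdiff]
    ring
  have hut : ∀ t ∈ Icc 0 T, ∀ x, pdt (fun t x => gasVolume γ (hdiff w t x)) t x =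
      (wx true t x + wx false t x) / 2 := by
    intro t ht x
    refine (((hasDerivAt_gasVolume hγ (hmem t ht x)).comp t (hkt t ht x)).congr_deriv ?_).deriv
    have := (hcpos t ht x).ne'
    field_simp
  have hux : ∀ t ∈ Icc 0 T, ∀ x, pdx (fun t x => gasVolume γ (hdiff w t x)) t x =
      1 / gasSpeed γ (hdiff w t x) * hdiff wx t x := fun t ht x =>
    ((hasDerivAt_gasVolume hγ (hmem t ht x)).comp x (hkx t ht x)).deriv
  have hpx : ∀ t ∈ Icc 0 T, ∀ x, pdx (fun t x => pres γ (gasVolume γ (hdiff w t x))) t x =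
      -gasSpeed γ (hdiff w t x) * hdiff wx t x := fun t ht x =>
    ((hasDerivAt_pres_gasVolume hγ (hmem t ht x)).comp x (hkx t ht x)).deriv
  have hS := speed_gasSpeed hγ
  have hbw : ∀ t ∈ Icc 0 T, ∀ x, |(w true t x + w false t x) / 2| ≤ P.M := by
    intro t ht x
    have h1 := abs_le.1 (h.bdd true t ⟨ht.1, ht.2.trans_lt hT⟩ x)
    have h2 := abs_le.1 (h.bdd false t ⟨ht.1, ht.2.trans_lt hT⟩ x)
    rw [abs_le]
    constructor <;> linarith [h1.1, h1.2, h2.1, h2.2]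
  have hbx : ∀ t ∈ Icc 0 T, ∀ x, |(wx true t x + wx false t x) / 2| ≤ P.N := by
    intro t ht x
    have h1 := abs_le.1 (h.bddx true t ⟨ht.1, ht.2.trans_lt hT⟩ x)
    have h2 := abs_le.1 (h.bddx false t ⟨ht.1, ht.2.trans_lt hT⟩ x)
    rw [abs_le]
    constructor <;> linarith [h1.1, h1.2, h2.1, h2.2]
  have hbk : ∀ t ∈ Icc 0 T, ∀ x, |hdiff wx t x| ≤ P.N := fun t ht x =>
    abs_hdiff_le fun i => h.bddx i t ⟨ht.1, ht.2.trans_lt hT⟩ x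
  refine ⟨⟨?_, (1 / 2) ^ (-2 / (γ - 1)) + P.N +
    1 / (1 / 2) ^ ((γ + 1) / (γ - 1)) * P.N, ?_⟩, ⟨?_, P.M +
    ((3 / 2) ^ ((γ + 1) / (γ - 1)) * P.N + |lam| * P.M) + P.N, ?_⟩, ?_, fun p hp =>
    gasVolume_pos hγ (hmem p.1 hp.1 p.2)⟩
  · exact (contDiffOn_gasVolume hγ).comp (((hC true).sub (hC false)).div_const 2)
      fun p hp => hmem p.1 hp.1 p.2
  · intro p hp
    have hm := hmem p.1 hp.1 p.2
    rw [hut p.1 hp.1, hux p.1 hp.1, abs_of_pos (gasVolume_pos hγ hm), abs_mul,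
      abs_of_pos (one_div_pos.2 (hcpos p.1 hp.1 p.2))]
    refine add_le_add (add_le_add (gasVolume_le hγ hm) (hbx p.1 hp.1 p.2)) ?_
    exact mul_le_mul (one_div_le_one_div_of_le hS.pos (hS.lower _ hm)) (hbk p.1 hp.1 p.2)
      (abs_nonneg _) (one_div_nonneg.2 hS.pos.le)
  · exact ((hC true).add (hC false)).div_const 2
  · intro p hp
    have hm := hmem p.1 hp.1 p.2
    rw [hvt p.1 hp.1, hvx p.1 hp.1]
    refine add_le_add (add_le_add (hbw p.1 hp.1 p.2) ?_) (hbx p.1 hp.1 p.2)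
    refine (abs_sub _ _).trans (add_le_add ?_ ?_)
    · rw [abs_mul, abs_of_pos (hcpos p.1 hp.1 p.2)]
      exact mul_le_mul (hS.upper _ hm) (hbk p.1 hp.1 p.2) (abs_nonneg _) (by positivity)
    · have h1 : (1 : ℝ) ≤ 1 + p.1 := by linarith [hp.1.1]
      rw [abs_mul, abs_div, abs_of_pos (zero_lt_one.trans_le h1)]
      exact mul_le_mul (div_le_self (abs_nonneg _) h1) (hbw p.1 hp.1 p.2) (abs_nonneg _)
        (abs_nonneg _)
  · intro p hp
    rw [hut p.1 hp.1, hvx p.1 hp.1, hvt p.1 hp.1, hpx p.1 hp.1, rpow_one]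
    exact ⟨sub_self _, by ring⟩

end RiemannProblem

lemma IsC1b.exists_bound {f : ℝ → ℝ} (hf : IsC1b f) :
    ∃ F, 0 ≤ F ∧ ∀ x, |f x| ≤ F ∧ |deriv f x| ≤ F := by
  obtain ⟨F, hF⟩ := hf.2
  have h : ∀ x, |f x| ≤ F ∧ |deriv f x| ≤ F := fun x =>
    ⟨by linarith [hF x, abs_nonneg (deriv f x)], by linarith [hF x, abs_nonneg (f x)]⟩
  exact ⟨F, (abs_nonneg _).trans (h 0).1, h⟩

/-- The Riemann invariants of the perturbed data `(1 + ε φ, ε ψ)`. -/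
def initInv (γ ε : ℝ) (φ ψ : ℝ → ℝ) (i : Bool) (x : ℝ) : ℝ :=
  ε * ψ x - sig i * gasInv γ (1 + ε * φ x)

/-- The derivative of `initInv`. -/
def initInvDeriv (γ ε : ℝ) (φ ψ : ℝ → ℝ) (i : Bool) (x : ℝ) : ℝ :=
  ε * deriv ψ x - sig i * ((1 + ε * φ x) ^ (-(γ + 1) / 2) * (ε * deriv φ x))

section InitialData

variable {γ ε F : ℝ} {φ ψ : ℝ → ℝ}

lemma half_le_one_add_mul {a : ℝ} (hε : 0 ≤ ε) (hεF : ε * F ≤ 1 / 2) (ha : |a| ≤ F) :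
    1 / 2 ≤ 1 + ε * a := by
  have h := mul_le_mul_of_nonneg_left (neg_le_of_abs_le ha) hε
  linarith

lemma hasDerivAt_initInv (hγ : 1 < γ) (hφ : IsC1b φ) (hψ : IsC1b ψ) (i : Bool) {x : ℝ}
    (hx : 0 < 1 + ε * φ x) :
    HasDerivAt (initInv γ ε φ ψ i) (initInvDeriv γ ε φ ψ i x) x := by
  have h1 := (hφ.1.differentiable one_ne_zero x).hasDerivAt
  have h2 := (hψ.1.differentiable one_ne_zero x).hasDerivAt
  have h3 : HasDerivAt (fun x => gasInv γ (1 + ε * φ x))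
      ((1 + ε * φ x) ^ (-(γ + 1) / 2) * (ε * deriv φ x)) x :=
    HasDerivAt.comp (h₂ := gasInv γ) x (hasDerivAt_gasInv hγ hx) ((h1.const_mul ε).const_add 1)
  exact (h2.const_mul ε).sub (h3.const_mul (sig i))

lemma continuous_initInvDeriv (hφ : IsC1b φ) (hψ : IsC1b ψ) (i : Bool)
    (hx : ∀ x, 0 < 1 + ε * φ x) : Continuous (initInvDeriv γ ε φ ψ i) := by
  have h1 := hφ.1.continuous_deriv le_rfl
  have h2 := hψ.1.continuous_deriv le_rfl
  have h3 : Continuous fun x => (1 + ε * φ x) ^ (-(γ + 1) / 2) :=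
    (continuous_const.add (continuous_const.mul hφ.1.continuous)).rpow_const
      fun x => Or.inl (hx x).ne'
  exact (continuous_const.mul h2).sub (continuous_const.mul (h3.mul (continuous_const.mul h1)))

lemma abs_initInv_le (hγ : 1 < γ) (hε : 0 ≤ ε) (hεF : ε * F ≤ 1 / 2) {x : ℝ} (hφ : |φ x| ≤ F)
    (hψ : |ψ x| ≤ F) (i : Bool) :
    |initInv γ ε φ ψ i x| ≤ F * (1 + (1 / 2) ^ (-(γ + 1) / 2)) * ε := by
  have h1 := abs_gasInv_le hγ (half_le_one_add_mul hε hεF hφ)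
  rw [add_sub_cancel_left, abs_mul, abs_of_nonneg hε] at h1
  have h2 : |gasInv γ (1 + ε * φ x)| ≤ (1 / 2) ^ (-(γ + 1) / 2) * (ε * F) :=
    h1.trans (by gcongr)
  refine (abs_sub _ _).trans ?_
  rw [abs_mul, abs_mul, abs_sig, one_mul, abs_of_nonneg hε]
  refine (add_le_add (mul_le_mul_of_nonneg_left hψ hε) h2).trans (le_of_eq ?_)
  ring

lemma abs_initInvDeriv_le (hγ : 1 < γ) (hε : 0 ≤ ε) (hεF : ε * F ≤ 1 / 2) {x : ℝ}
    (hφ : |φ x| ≤ F) (hφ' : |deriv φ x| ≤ F) (hψ' : |deriv ψ x| ≤ F) (i : Bool) :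
    |initInvDeriv γ ε φ ψ i x| ≤ F * (1 + (1 / 2) ^ (-(γ + 1) / 2)) * ε := by
  have h1 := rpow_gasInv_deriv_le hγ (half_le_one_add_mul hε hεF hφ)
  refine (abs_sub _ _).trans ?_
  rw [abs_mul, abs_mul, abs_mul, abs_mul, abs_sig, one_mul, abs_of_nonneg hε]
  refine (add_le_add (mul_le_mul_of_nonneg_left hψ' hε) (mul_le_mul h1
    (mul_le_mul_of_nonneg_left hφ' hε) (mul_nonneg hε (abs_nonneg _)) (by positivity))).trans
    (le_of_eq ?_)
  ring

end InitialData

lemma one_add_rpow_lifespan_le {n Q ε : ℝ} (hn : 0 < n) (hQ : 0 ≤ Q) (hε : 0 < ε)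
    (h : ε ≤ (1 / 2 * (1 + Q) ^ (-(1 / n)) / 2) ^ n) :
    (1 + (1 / 2 * (1 + Q) ^ (-(1 / n)) * ε ^ (-(1 / n)) + 1)) ^ n ≤ 1 / ((1 + Q) * ε) := by
  have hQ1 : 0 < 1 + Q := by linarith
  set C := 1 / 2 * (1 + Q) ^ (-(1 / n)) with hC
  have hCpos : 0 < C := by positivity
  have hn' : -(1 / n) ≤ 0 := by
    have := one_div_pos.2 hn
    linarith
  have h1 : 2 / C ≤ ε ^ (-(1 / n)) := by
    have h2 := rpow_le_rpow_of_nonpos hε h hn'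
    rw [← rpow_mul (by positivity), mul_neg, mul_one_div_cancel hn.ne', rpow_neg_one,
      inv_div] at h2
    exact h2
  have h2 : 2 ≤ C * ε ^ (-(1 / n)) := by
    have := mul_le_mul_of_nonneg_left h1 hCpos.le
    rwa [mul_div_cancel₀ _ hCpos.ne'] at this
  calc (1 + (C * ε ^ (-(1 / n)) + 1)) ^ n ≤ (2 * (C * ε ^ (-(1 / n)))) ^ n :=
        rpow_le_rpow (by linarith) (by linarith) hn.le
    _ = ((1 + Q) ^ (-(1 / n)) * ε ^ (-(1 / n))) ^ n := by rw [hC]; congr 1; ring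
    _ = 1 / ((1 + Q) * ε) := by
        rw [mul_rpow (by positivity) (by positivity), ← rpow_mul hQ1.le, ← rpow_mul hε.le,
          neg_mul, one_div_mul_cancel hn.ne', rpow_neg_one, rpow_neg_one, one_div, mul_inv]

/-- Smallness conditions on the data and on the time `T` under which the damped Euler system with
data `(1 + ε φ, ε ψ)` has a classical solution on every strip shorter than `T`. -/
lemma exists_euler_of_small {γ lam ε F M N T S c₀ c₁ K : ℝ} {φ ψ : ℝ → ℝ} (hγ : 1 < γ)
    (hφ : IsC1b φ) (hψ : IsC1b ψ) (hlam0 : 0 ≤ lam) (hlam2 : lam / 2 < 1)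
    (hφF : ∀ x, |φ x| ≤ F ∧ |deriv φ x| ≤ F) (hψF : ∀ x, |ψ x| ≤ F ∧ |deriv ψ x| ≤ F)
    (hε : 0 ≤ ε) (hεF : ε * F ≤ 1 / 2)
    (hM : F * (1 + (1 / 2) ^ (-(γ + 1) / 2)) * ε = M) (hMρ : M ≤ 1 / (γ - 1))
    (hc₀ : (1 / 2) ^ ((γ + 1) / (γ - 1)) = c₀) (hc₁ : (3 / 2) ^ ((γ + 1) / (γ - 1)) = c₁)
    (hK : (γ + 1) / 2 * (3 / 2) ^ (2 / (γ - 1)) = K)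
    (hN : exp 1 * (M + M / (2 * c₀) * (3 + 3 * (1 / (1 - lam / 2)) + 1 / (2 * c₀))) ≤ N)
    (hMN : M ≤ N) (hT : 0 ≤ T)
    (h_int : 2 * K * N * ((c₁ + 2) + c₁ + 1) *
      ∫ s in (0 : ℝ)..T, 1 / (1 + |s|) ^ (lam / 2) ≤ 1) (hST : S < T) :
    ∃ u v : ℝ → ℝ → ℝ, IsC1bOn u (strip S) ∧ IsC1bOn v (strip S) ∧
      IsEulerOn γ lam 1 u v (strip S) ∧ (∀ x, u 0 x = 1 + ε * φ x ∧ v 0 x = ε * ψ x) ∧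
      ∀ p ∈ strip S, 0 < u p.1 p.2 := by
  have hpos : ∀ x, 0 < 1 + ε * φ x := fun x =>
    lt_of_lt_of_le (by norm_num) (half_le_one_add_mul hε hεF (hφF x).1)
  have hm0 : 0 ≤ lam / 2 := by positivity
  have hspeed : Speed (gasSpeed γ) (gasSpeedDeriv γ) (1 / (γ - 1)) c₀ c₁ K := by
    rw [← hc₀, ← hc₁, ← hK]
    exact speed_gasSpeed hγ
  let P : RiemannProblem :=
    { A := fun t => (1 + |t|) ^ (lam / 2)
      a := fun t => lam / 2 * (1 + |t|) ^ (lam / 2 - 1)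
      a' := fun t => lam / 2 * (lam / 2 - 1) * (1 + |t|) ^ (lam / 2 - 2)
      H := fun t => (1 + |t|) ^ (lam / 2 - 2)
      c := gasSpeed γ
      c' := gasSpeedDeriv γ
      w₀ := initInv γ ε φ ψ
      w₀' := initInvDeriv γ ε φ ψ
      H₀ := 1 / (1 - lam / 2)
      ρ := 1 / (γ - 1)
      c₀ := c₀
      c₁ := c₁
      K := K
      M := M
      N := N
      N₀ := M
      T := T
      damping := damping_rpow hm0 hlam2
      speed := hspeed
      M_le_ρ := hMρ
      M_le_N := hMN
      hasDerivAt_w₀ := fun i x => hasDerivAt_initInv hγ hφ hψ i (hpos x)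
      cont_w₀' := fun i => continuous_initInvDeriv hφ hψ i hpos
      abs_w₀_le := fun i x => hM ▸ abs_initInv_le hγ hε hεF (hφF x).1 (hψF x).1 i
      abs_w₀'_le := fun i x =>
        hM ▸ abs_initInvDeriv_le hγ hε hεF (hφF x).1 (hφF x).2 (hψF x).2 i
      le_N := hN
      T_nonneg := hT
      int_le := h_int }
  obtain ⟨w, wx, h⟩ := P.exists_classicalSolution
  have ha : ∀ t, 0 ≤ t → P.a t / P.A t = lam / 2 / (1 + t) := fun t ht => by
    have ht' : 0 < 1 + t := by linarith
    change lam / 2 * (1 + |t|) ^ (lam / 2 - 1) / (1 + |t|) ^ (lam / 2) = lam / 2 / (1 + t)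
    rw [abs_of_nonneg ht, rpow_sub_one ht'.ne']
    have := (rpow_pos_of_pos ht' (lam / 2)).ne'
    field_simp
  obtain ⟨h1, h2, h3, h4⟩ := h.exists_euler hγ hST hMρ rfl ha
  refine ⟨_, _, h1, h2, h3, fun x => ?_, h4⟩
  have ht : w true 0 x = initInv γ ε φ ψ true x := h.init true x
  have hf : w false 0 x = initInv γ ε φ ψ false x := h.init false x
  have hd : hdiff w 0 x = gasInv γ (1 + ε * φ x) := by
    simp only [hdiff, ht, hf, initInv, sig]
    ring
  constructor
  · rw [hd, gasVolume_gasInv hγ (hpos x)]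
  · simp only [ht, hf, initInv, sig]
    ring

/-- For `μ = 1` and `0 ≤ λ < 2`, the lifespan satisfies
`T* ≥ C ε^(-2/(2-λ))`. -/
theorem lifespan_lower_bound_mu_one_lam_lt_two
    (γ lam : ℝ) (φ ψ : ℝ → ℝ) (hγ : 1 < γ)
    (hφ : IsC1b φ) (hψ : IsC1b ψ) (hlam0 : 0 ≤ lam) (hlam2 : lam < 2) :
    ∃ ε₀ > 0, ∃ C > 0, ∀ ε : ℝ, 0 < ε → ε ≤ ε₀ →
      ∃ u v : ℝ → ℝ → ℝ,
        IsC1bOn u (strip (C * ε ^ (-(2 / (2 - lam))))) ∧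
        IsC1bOn v (strip (C * ε ^ (-(2 / (2 - lam))))) ∧
        IsEulerOn γ lam 1 u v (strip (C * ε ^ (-(2 / (2 - lam))))) ∧
        (∀ x, u 0 x = 1 + ε * φ x ∧ v 0 x = ε * ψ x) ∧
        (∀ p ∈ strip (C * ε ^ (-(2 / (2 - lam)))), 0 < u p.1 p.2) := by
  obtain ⟨F₁, hF₁0, hF₁⟩ := hφ.exists_bound
  obtain ⟨F₂, hF₂0, hF₂⟩ := hψ.exists_bound
  obtain ⟨F, hF⟩ : ∃ F, F₁ + F₂ = F := ⟨_, rfl⟩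
  have hF0 : 0 ≤ F := hF ▸ add_nonneg hF₁0 hF₂0
  have hφF : ∀ x, |φ x| ≤ F ∧ |deriv φ x| ≤ F := fun x =>
    ⟨by linarith [(hF₁ x).1], by linarith [(hF₁ x).2]⟩
  have hψF : ∀ x, |ψ x| ≤ F ∧ |deriv ψ x| ≤ F := fun x =>
    ⟨by linarith [(hF₂ x).1], by linarith [(hF₂ x).2]⟩
  have hγ0 : 0 < γ - 1 := by linarith
  have hγ1 : 0 < γ + 1 := by linarith
  obtain ⟨n, hn'⟩ : ∃ n, 1 - lam / 2 = n := ⟨_, rfl⟩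
  have hn : 0 < n := by linarith
  have hexp : 2 / (2 - lam) = 1 / n := by
    rw [show 2 - lam = 2 * n by linarith]
    field_simp
  obtain ⟨c₀, hc₀⟩ : ∃ c₀ : ℝ, (1 / 2) ^ ((γ + 1) / (γ - 1)) = c₀ := ⟨_, rfl⟩
  obtain ⟨c₁, hc₁⟩ : ∃ c₁ : ℝ, (3 / 2) ^ ((γ + 1) / (γ - 1)) = c₁ := ⟨_, rfl⟩
  obtain ⟨K, hK⟩ : ∃ K : ℝ, (γ + 1) / 2 * (3 / 2) ^ (2 / (γ - 1)) = K := ⟨_, rfl⟩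
  obtain ⟨D, hD⟩ : ∃ D, F * (1 + (1 / 2) ^ (-(γ + 1) / 2)) = D := ⟨_, rfl⟩
  have hc₀p : 0 < c₀ := hc₀ ▸ by positivity
  have hc₁p : 0 < c₁ := hc₁ ▸ by positivity
  have hKp : 0 < K := hK ▸ by positivity
  have hD0 : 0 ≤ D := hD ▸ by positivity
  obtain ⟨G, hG⟩ : ∃ G, 1 / (2 * c₀) * (3 + 3 * (1 / n) + 1 / (2 * c₀)) = G := ⟨_, rfl⟩
  have hG0 : 0 ≤ G := hG ▸ by positivity
  obtain ⟨B, hB⟩ : ∃ B, exp 1 * (D + D * G) = B := ⟨_, rfl⟩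
  have hB0 : 0 ≤ B := hB ▸ by positivity
  have hDB : D ≤ B := by
    have h1 := one_le_exp zero_le_one
    have h2 := mul_nonneg hD0 hG0
    nlinarith
  obtain ⟨Q, hQ⟩ : ∃ Q, 2 * K * B * ((c₁ + 2) + c₁ + 1) / n = Q := ⟨_, rfl⟩
  have hQ0 : 0 ≤ Q := hQ ▸ by positivity
  obtain ⟨C, hC⟩ : ∃ C, 1 / 2 * (1 + Q) ^ (-(1 / n)) = C := ⟨_, rfl⟩
  have hCp : 0 < C := hC ▸ by positivity
  refine ⟨min (1 / (2 * (F + 1))) (min (1 / ((γ - 1) * (D + 1))) ((C / 2) ^ n)),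
    by positivity, C, hCp, fun ε hε hε₀ => ?_⟩
  rw [hexp]
  obtain ⟨hε1, hε2, hε3⟩ := by simpa only [le_min_iff] using hε₀
  have hεF : ε * F ≤ 1 / 2 := by
    rw [le_div_iff₀ (by positivity)] at hε1
    linarith
  have hM : D * ε ≤ 1 / (γ - 1) := by
    rw [le_div_iff₀ (by positivity)] at hε2 ⊢
    nlinarith [mul_pos hε hγ0]
  have hT0 : 0 ≤ C * ε ^ (-(1 / n)) + 1 := by positivity
  refine exists_euler_of_small hγ hφ hψ hlam0 (by linarith) hφF hψF hε.le hεF (by rw [hD]) hM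
    hc₀ hc₁ hK (N := B * ε) (le_of_eq ?_) (mul_le_mul_of_nonneg_right hDB hε.le) hT0 ?_
    (lt_add_one _)
  · rw [hn', ← hB, ← hG]
    ring
  · have h0 := one_add_rpow_lifespan_le hn hQ0 hε (by rwa [hC])
    have h1 := integral_one_div_rpow_le (m := lam / 2) (by linarith) hT0
    rw [hC] at h0
    rw [hn'] at h1
    replace h1 := h1.trans (div_le_div_of_nonneg_right h0 hn.le)
    refine (mul_le_mul_of_nonneg_left h1 (by positivity)).trans ?_
    have e : 2 * K * (B * ε) * ((c₁ + 2) + c₁ + 1) * (1 / ((1 + Q) * ε) / n) = Q / (1 + Q) := by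
      nth_rw 2 [← hQ]
      field_simp
    rw [e, div_le_one (by positivity)]
    linarith
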